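/- arXiv:2012.06355 — 4 statements merged into one kernel-verified Lean document; each statement's English description precedes it below -/
import Mathlib

section
/- Generator of a continuous semigroup: let (F_t)_{t≥0} be a family of holomorphic self-maps of the unit disc 𝔻 with F_0 = id, F_{t+s} = F_t ∘ F_s for all s, t ≥ 0, and t ↦ F_t continuous with respect to locally uniform convergence on 𝔻. Then the limit G(z) := lim_{t↓0} (F_t(z) − z)/t exists locally uniformly on 𝔻 and defines a holomorphic function G : 𝔻 → ℂ; moreover F_t(z) = z + ∫₀ᵗ G(F_s(z)) ds for all z ∈ 𝔻 and t ≥ 0, so that t ↦ F_t(z) is the unique solution of the initial value problem ∂_t F_t(z) = G(F_t(z)), F_0(z) = z. In addition, every F_t is injective. -/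
open Filter Topology Set MeasureTheory

/-- `F` is a continuous one-parameter semigroup of holomorphic self-maps of the unit disc. -/
structure IsDiscSemigroup (F : ℝ → ℂ → ℂ) : Prop where
  mapsTo : ∀ t, 0 ≤ t → MapsTo (F t) (Metric.ball (0 : ℂ) 1) (Metric.ball (0 : ℂ) 1)
  differentiableOn : ∀ t, 0 ≤ t → DifferentiableOn ℂ (F t) (Metric.ball (0 : ℂ) 1)
  zero_apply : ∀ z ∈ Metric.ball (0 : ℂ) 1, F 0 z = z
  add_apply : ∀ s t : ℝ, 0 ≤ s → 0 ≤ t →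
    ∀ z ∈ Metric.ball (0 : ℂ) 1, F (t + s) z = F t (F s z)
  tendsto : ∀ t₀ : ℝ, 0 ≤ t₀ →
    TendstoLocallyUniformlyOn (fun t => F t) (F t₀) (𝓝[Ici 0] t₀) (Metric.ball (0 : ℂ) 1)

/-- The infinitesimal generator of a semigroup: the right derivative of the orbits at time `0`. -/
noncomputable def semigroupGenerator (F : ℝ → ℂ → ℂ) (z : ℂ) : ℂ :=
  derivWithin (fun t => F t z) (Ici 0) 0

/-- If `H ∘ φ` has a right derivative and `H` has a nonvanishing strict derivative, then `φ`
has a right derivative. -/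
theorem HasDerivWithinAt.of_comp_hasStrictDerivAt {φ : ℝ → ℂ} {H : ℂ → ℂ} {s : Set ℝ} {a : ℝ}
    {H' d : ℂ} (ha : a ∈ s) (hφ : ContinuousWithinAt φ s a)
    (hH : HasStrictDerivAt H H' (φ a)) (hH' : H' ≠ 0)
    (hc : HasDerivWithinAt (fun t => H (φ t)) d s a) :
    HasDerivWithinAt φ (d / H') s a := by
  have hinv := (hH.to_localInverse hH').hasDerivAt
  refine (hinv.comp_hasDerivWithinAt a hc).congr_of_eventuallyEq_of_mem ?_ ha |>.congr_deriv ?_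
  · filter_upwards [hφ.eventually (hH.eventually_left_inverse hH')] with t ht using ht.symm
  · rw [div_eq_inv_mul]

namespace IsDiscSemigroup

variable {F : ℝ → ℂ → ℂ} {z : ℂ}

theorem continuousOn_orbit (hF : IsDiscSemigroup F) (hz : z ∈ Metric.ball (0 : ℂ) 1) :
    ContinuousOn (fun t => F t z) (Ici 0) := fun t ht =>
  (hF.tendsto t ht).tendsto_at hz

theorem continuousOn_deriv (hF : IsDiscSemigroup F) (hz : z ∈ Metric.ball (0 : ℂ) 1) :
    ContinuousOn (fun t => deriv (F t) z) (Ici 0) := fun t ht => by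
  have := (hF.tendsto t ht).deriv
    (by filter_upwards [self_mem_nhdsWithin] with s hs using hF.differentiableOn s hs)
    Metric.isOpen_ball
  exact this.tendsto_at hz

theorem intervalIntegrable_orbit (hF : IsDiscSemigroup F) (hz : z ∈ Metric.ball (0 : ℂ) 1)
    {a b : ℝ} (ha : 0 ≤ a) (hb : 0 ≤ b) : IntervalIntegrable (fun t => F t z) volume a b :=
  ((hF.continuousOn_orbit hz).mono fun _ hx => (le_min ha hb).trans hx.1).intervalIntegrable

/-- Cauchy's estimate, uniform in time. -/
theorem norm_deriv_le (hF : IsDiscSemigroup F) {r : ℝ} (hr : r < 1) {t : ℝ} (ht : 0 ≤ t)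
    (hz : ‖z‖ ≤ r) : ‖deriv (F t) z‖ ≤ 1 / ((1 - r) / 2) := by
  have hsub : Metric.closedBall z ((1 - r) / 2) ⊆ Metric.ball 0 1 := by
    intro w hw
    rw [mem_closedBall_iff_norm] at hw
    rw [mem_ball_zero_iff]
    have := norm_le_norm_add_norm_sub' w z
    linarith
  refine Complex.norm_deriv_le_of_forall_mem_sphere_norm_le (by linarith) ?_ ?_
  · refine DifferentiableOn.diffContOnCl ?_
    exact (hF.differentiableOn t ht).mono (Metric.closure_ball_subset_closedBall.trans hsub)
  · intro w hw
    have := hF.mapsTo t ht (hsub (Metric.sphere_subset_closedBall hw))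
    rw [mem_ball_zero_iff] at this
    exact this.le

theorem hasDerivAt_integral (hF : IsDiscSemigroup F) (hz : z ∈ Metric.ball (0 : ℂ) 1) {h : ℝ}
    (hh : 0 ≤ h) :
    HasDerivAt (fun w => ∫ s in (0 : ℝ)..h, F s w) (∫ s in (0 : ℝ)..h, deriv (F s) z) z := by
  obtain ⟨r, hzr, hr⟩ := exists_between (mem_ball_zero_iff.1 hz)
  have hpos : ∀ t ∈ uIoc 0 h, 0 ≤ t := fun t ht => by
    rw [uIoc_of_le hh] at ht
    exact ht.1.le
  have hsub : Metric.ball (0 : ℂ) r ⊆ Metric.ball 0 1 := Metric.ball_subset_ball hr.le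
  have hnhds : Metric.ball (0 : ℂ) r ∈ 𝓝 z :=
    Metric.isOpen_ball.mem_nhds (mem_ball_zero_iff.2 hzr)
  refine (intervalIntegral.hasDerivAt_integral_of_dominated_loc_of_deriv_le
    (F := fun w s => F s w) (F' := fun w s => deriv (F s) w)
    (bound := fun _ => 1 / ((1 - r) / 2)) hnhds ?_ ?_ ?_ ?_ ?_ ?_).2
  · filter_upwards [hnhds] with w hw
    exact ((hF.continuousOn_orbit (hsub hw)).mono hpos).aestronglyMeasurable measurableSet_uIoc
  · exact hF.intervalIntegrable_orbit hz le_rfl hh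
  · exact ((hF.continuousOn_deriv hz).mono hpos).aestronglyMeasurable measurableSet_uIoc
  · exact ae_of_all _ fun t ht w hw =>
      hF.norm_deriv_le hr (hpos t ht) (mem_ball_zero_iff.1 hw).le
  · exact intervalIntegrable_const
  · exact ae_of_all _ fun t ht w hw => ((hF.differentiableOn t (hpos t ht)).differentiableAt
      (Metric.isOpen_ball.mem_nhds (hsub hw))).hasDerivAt

/-- For small positive `h` the time average over `[0, h]` is locally invertible. -/
theorem exists_integral_deriv_ne_zero (hF : IsDiscSemigroup F)
    (hz : z ∈ Metric.ball (0 : ℂ) 1) :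
    ∃ h : ℝ, 0 < h ∧ ∫ s in (0 : ℝ)..h, deriv (F s) z ≠ 0 := by
  have h0 : deriv (F 0) z = 1 := by
    have : F 0 =ᶠ[𝓝 z] id := by
      filter_upwards [Metric.isOpen_ball.mem_nhds hz] with w hw using hF.zero_apply w hw
    rw [this.deriv_eq, deriv_id]
  have hc := hF.continuousOn_deriv hz
  obtain ⟨δ, hδ, hlt⟩ := Metric.continuousWithinAt_iff.1 (hc 0 self_mem_Ici) (1 / 2) (by norm_num)
  refine ⟨δ / 2, by positivity, fun hzero => ?_⟩
  have hint : IntervalIntegrable (fun s => deriv (F s) z) volume 0 (δ / 2) := by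
    refine (hc.mono fun x hx => ?_).intervalIntegrable
    rw [uIcc_of_le (by positivity)] at hx
    exact hx.1
  have hb : ‖∫ s in (0 : ℝ)..(δ / 2), (deriv (F s) z - 1)‖ ≤ 1 / 2 * |δ / 2 - 0| := by
    refine intervalIntegral.norm_integral_le_of_norm_le_const fun s hs => ?_
    rw [uIoc_of_le (by positivity)] at hs
    have := hlt (x := s) hs.1.le (by
      rw [Real.dist_eq, sub_zero, abs_of_pos hs.1]
      linarith [hs.2])
    rw [h0, dist_eq_norm] at this
    exact this.le
  rw [intervalIntegral.integral_sub hint intervalIntegrable_const, hzero] at hb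
  simp only [intervalIntegral.integral_const, zero_sub, norm_neg, norm_smul, norm_one, sub_zero,
    mul_one, Real.norm_eq_abs] at hb
  rw [abs_of_pos (by positivity)] at hb
  linarith

/-- Averaging over `[0, h]` turns orbits into differentiable curves. -/
theorem hasDerivWithinAt_integral_orbit (hF : IsDiscSemigroup F)
    (hz : z ∈ Metric.ball (0 : ℂ) 1) {h : ℝ} (hh : 0 < h) :
    HasDerivWithinAt (fun t => ∫ s in (0 : ℝ)..h, F s (F t z)) (F h z - z) (Ici 0) 0 := by
  have hc := hF.continuousOn_orbit hz
  have hprim : ∀ a, 0 ≤ a →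
      HasDerivWithinAt (fun u => ∫ x in (0 : ℝ)..u, F x z) (F a z) (Ici a) a := by
    intro a ha
    refine intervalIntegral.integral_hasDerivWithinAt_right
      (hF.intervalIntegrable_orbit hz le_rfl ha) (t := Ioi a) ?_ ?_
    · exact (hc.mono fun x hx => ha.trans (le_of_lt hx)).stronglyMeasurableAtFilter_nhdsWithin
        measurableSet_Ioi _
    · exact (hc a ha).mono fun x hx => ha.trans (le_of_lt hx)
  have h1 : HasDerivWithinAt (fun t => ∫ x in (0 : ℝ)..(t + h), F x z) (F h z) (Ici 0) 0 := by
    have hp : HasDerivWithinAt (fun u => ∫ x in (0 : ℝ)..u, F x z) (F h z) (Ici h) (0 + h) := by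
      simpa using hprim h hh.le
    have := HasDerivWithinAt.scomp (𝕜 := ℝ) (0 : ℝ) hp
      ((hasDerivWithinAt_id (0 : ℝ) (Ici 0)).add_const h)
      (fun t (ht : 0 ≤ t) => by simpa using ht)
    simpa [Function.comp_def] using this
  have h2 := h1.sub (hprim 0 le_rfl)
  rw [hF.zero_apply z hz] at h2
  refine h2.congr_of_mem (fun t (ht : 0 ≤ t) => ?_) self_mem_Ici
  rw [Pi.sub_apply, intervalIntegral.integral_interval_sub_left
    (hF.intervalIntegrable_orbit hz le_rfl (by positivity))
    (hF.intervalIntegrable_orbit hz le_rfl ht)]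
  have : ∀ s ∈ uIcc 0 h, F s (F t z) = F (s + t) z := fun s hs => by
    rw [uIcc_of_le hh.le] at hs
    exact (hF.add_apply t s ht hs.1 z hz).symm
  rw [intervalIntegral.integral_congr this,
    intervalIntegral.integral_comp_add_right (fun s => F s z), zero_add, add_comm]

theorem exists_eventually_hasDerivWithinAt (hF : IsDiscSemigroup F)
    (hz : z ∈ Metric.ball (0 : ℂ) 1) :
    ∃ g : ℂ → ℂ, DifferentiableAt ℂ g z ∧
      ∀ᶠ w in 𝓝 z, HasDerivWithinAt (fun t => F t w) (g w) (Ici 0) 0 := by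
  obtain ⟨h, hh, hne⟩ := hF.exists_integral_deriv_ne_zero hz
  set H : ℂ → ℂ := fun w => ∫ s in (0 : ℝ)..h, F s w
  have hball : Metric.ball (0 : ℂ) 1 ∈ 𝓝 z := Metric.isOpen_ball.mem_nhds hz
  have hH : DifferentiableOn ℂ H (Metric.ball 0 1) := fun w hw =>
    (hF.hasDerivAt_integral hw hh.le).differentiableAt.differentiableWithinAt
  have hne' : deriv H z ≠ 0 := by rwa [(hF.hasDerivAt_integral hz hh.le).deriv]
  have hdH : DifferentiableAt ℂ (deriv H) z :=
    (hH.deriv Metric.isOpen_ball).differentiableAt hball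
  refine ⟨fun w => (F h w - w) / deriv H w, ?_, ?_⟩
  · exact (((hF.differentiableOn h hh.le).differentiableAt hball).sub differentiableAt_id).div
      hdH hne'
  · filter_upwards [hball, hdH.continuousAt.eventually_ne hne'] with w hw hwne
    have hstrict : HasStrictDerivAt H (deriv H w) (F 0 w) := by
      rw [hF.zero_apply w hw]
      exact (hH.analyticAt (Metric.isOpen_ball.mem_nhds hw)).hasStrictDerivAt
    exact HasDerivWithinAt.of_comp_hasStrictDerivAt self_mem_Ici
      (hF.continuousOn_orbit hw 0 self_mem_Ici) hstrict hwne
      (hF.hasDerivWithinAt_integral_orbit hw hh)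

theorem hasDerivWithinAt_zero (hF : IsDiscSemigroup F) (hz : z ∈ Metric.ball (0 : ℂ) 1) :
    HasDerivWithinAt (fun t => F t z) (semigroupGenerator F z) (Ici 0) 0 := by
  obtain ⟨g, -, hg⟩ := hF.exists_eventually_hasDerivWithinAt hz
  exact hg.self_of_nhds.differentiableWithinAt.hasDerivWithinAt

theorem differentiableOn_generator (hF : IsDiscSemigroup F) :
    DifferentiableOn ℂ (semigroupGenerator F) (Metric.ball 0 1) := by
  intro z hz
  obtain ⟨g, hgd, hg⟩ := hF.exists_eventually_hasDerivWithinAt hz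
  refine (hgd.congr_of_eventuallyEq ?_).differentiableWithinAt
  filter_upwards [hg] with w hw
  exact hw.derivWithin (uniqueDiffOn_Ici 0 0 self_mem_Ici)

theorem hasDerivWithinAt_orbit (hF : IsDiscSemigroup F) (hz : z ∈ Metric.ball (0 : ℂ) 1)
    {t : ℝ} (ht : 0 ≤ t) :
    HasDerivWithinAt (fun s => F s z) (semigroupGenerator F (F t z)) (Ici t) t := by
  have h0 : HasDerivWithinAt (fun s => F s (F t z)) (semigroupGenerator F (F t z)) (Ici 0)
      (t - t) := by
    simpa using hF.hasDerivWithinAt_zero (hF.mapsTo t ht hz)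
  have := HasDerivWithinAt.scomp (𝕜 := ℝ) (h := fun s => s - t) t h0
      ((hasDerivWithinAt_id t (Ici t)).sub_const t)
      (fun s (hs : t ≤ s) => by simpa using hs)
  rw [one_smul] at this
  refine this.congr_of_mem (fun s (hs : t ≤ s) => ?_) self_mem_Ici
  simpa using hF.add_apply t (s - t) ht (sub_nonneg.2 hs) z hz

theorem continuousOn_generator_orbit (hF : IsDiscSemigroup F)
    (hz : z ∈ Metric.ball (0 : ℂ) 1) :
    ContinuousOn (fun s => semigroupGenerator F (F s z)) (Ici 0) :=
  hF.differentiableOn_generator.continuousOn.comp (hF.continuousOn_orbit hz)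
    fun t ht => hF.mapsTo t ht hz

theorem intervalIntegrable_generator_orbit (hF : IsDiscSemigroup F)
    (hz : z ∈ Metric.ball (0 : ℂ) 1) {t : ℝ} (ht : 0 ≤ t) :
    IntervalIntegrable (fun s => semigroupGenerator F (F s z)) volume 0 t := by
  refine ((hF.continuousOn_generator_orbit hz).mono fun s hs => ?_).intervalIntegrable
  rw [uIcc_of_le ht] at hs
  exact hs.1

theorem eq_add_integral (hF : IsDiscSemigroup F) (hz : z ∈ Metric.ball (0 : ℂ) 1) {t : ℝ}
    (ht : 0 ≤ t) : F t z = z + ∫ s in (0 : ℝ)..t, semigroupGenerator F (F s z) := by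
  rw [intervalIntegral.integral_eq_sub_of_hasDeriv_right_of_le (f := fun s => F s z) ht
    ((hF.continuousOn_orbit hz).mono Icc_subset_Ici_self)
    (fun s hs => (hF.hasDerivWithinAt_orbit hz hs.1.le).mono Ioi_subset_Ici_self)
    (hF.intervalIntegrable_generator_orbit hz ht), hF.zero_apply z hz]
  ring

theorem tendstoLocallyUniformlyOn_generator (hF : IsDiscSemigroup F) :
    TendstoLocallyUniformlyOn (fun t z => (F t z - z) / (t : ℂ)) (semigroupGenerator F)
      (𝓝[>] 0) (Metric.ball (0 : ℂ) 1) := by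
  rw [Metric.tendstoLocallyUniformlyOn_iff]
  intro ε hε x hx
  have hGx : ContinuousAt (semigroupGenerator F) x :=
    hF.differentiableOn_generator.continuousOn.continuousAt (Metric.isOpen_ball.mem_nhds hx)
  obtain ⟨δ, hδ, hG⟩ := Metric.continuousAt_iff.1 hGx (ε / 4) (by positivity)
  obtain ⟨U, hU, hUF⟩ := Metric.tendstoLocallyUniformlyOn_iff.1 (hF.tendsto 0 le_rfl) (δ / 2)
    (by positivity) x hx
  refine ⟨U ∩ (Metric.ball 0 1 ∩ Metric.ball x (δ / 2)), inter_mem hU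
    (inter_mem self_mem_nhdsWithin (mem_nhdsWithin_of_mem_nhds
      (Metric.ball_mem_nhds x (by positivity)))), ?_⟩
  obtain ⟨η, hη, hηF⟩ := Metric.eventually_nhds_iff.1 (eventually_nhdsWithin_iff.1 hUF)
  filter_upwards [Ioo_mem_nhdsGT hη] with t ht y hy
  obtain ⟨hyU, hy1, hyx⟩ := hy
  have ht0 : (t : ℂ) ≠ 0 := by exact_mod_cast ht.1.ne'
  have hGy : dist (semigroupGenerator F y) (semigroupGenerator F x) < ε / 4 :=
    hG (lt_trans hyx (by linarith))
  have hbound : ‖∫ s in (0 : ℝ)..t, (semigroupGenerator F (F s y) - semigroupGenerator F y)‖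
      ≤ ε / 2 * |t - 0| := by
    refine intervalIntegral.norm_integral_le_of_norm_le_const fun s hs => ?_
    rw [uIoc_of_le ht.1.le] at hs
    have hsy : dist (F 0 y) (F s y) < δ / 2 := by
      refine hηF ?_ hs.1.le y hyU
      rw [Real.dist_eq, sub_zero, abs_of_pos hs.1]
      exact hs.2.trans_lt ht.2
    rw [hF.zero_apply y hy1] at hsy
    have hGs : dist (semigroupGenerator F (F s y)) (semigroupGenerator F x) < ε / 4 := by
      refine hG ((dist_triangle_left _ _ y).trans_lt ?_)
      have := Metric.mem_ball.1 hyx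
      linarith
    rw [← dist_eq_norm]
    have := dist_triangle_right (semigroupGenerator F (F s y)) (semigroupGenerator F y)
      (semigroupGenerator F x)
    linarith
  rw [intervalIntegral.integral_sub (hF.intervalIntegrable_generator_orbit hy1 ht.1.le)
    intervalIntegrable_const, intervalIntegral.integral_const, sub_zero, abs_of_pos ht.1,
    Complex.real_smul, ← sub_eq_iff_eq_add'.2 (hF.eq_add_integral hy1 ht.1.le)] at hbound
  rw [dist_comm, dist_eq_norm]
  have heq : (F t y - y) / (t : ℂ) - semigroupGenerator F y
      = (F t y - y - t * semigroupGenerator F y) / t := by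
    field_simp
  rw [heq, norm_div, Complex.norm_real, Real.norm_of_nonneg ht.1.le, div_lt_iff₀ ht.1]
  have := mul_pos hε ht.1
  linarith

theorem hasDerivWithinAt_orbit_left (hF : IsDiscSemigroup F) (hz : z ∈ Metric.ball (0 : ℂ) 1)
    {t : ℝ} (ht : 0 < t) :
    HasDerivWithinAt (fun s => F s z) (semigroupGenerator F (F t z)) (Iic t) t := by
  have hc := hF.continuousOn_generator_orbit hz
  have hd : HasDerivAt (fun u => z + ∫ s in (0 : ℝ)..u, semigroupGenerator F (F s z))
      (semigroupGenerator F (F t z)) t := by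
    refine (intervalIntegral.integral_hasDerivAt_right
      (hF.intervalIntegrable_generator_orbit hz ht.le) ?_ ?_).const_add z
    · exact (hc.mono Ioi_subset_Ici_self).stronglyMeasurableAtFilter isOpen_Ioi _ ht
    · exact hc.continuousAt (Ici_mem_nhds ht)
  refine (hd.congr_of_eventuallyEq ?_).hasDerivWithinAt
  filter_upwards [Ioi_mem_nhds ht] with s hs using hF.eq_add_integral hz (le_of_lt hs)

theorem exists_lipschitz_nhds (hF : IsDiscSemigroup F) (hz : z ∈ Metric.ball (0 : ℂ) 1) :
    ∃ K, ∃ U ∈ 𝓝 z, LipschitzOnWith K (semigroupGenerator F) U :=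
  (hF.differentiableOn_generator.analyticAt
    (Metric.isOpen_ball.mem_nhds hz)).contDiffAt.exists_lipschitzOnWith

theorem injOn (hF : IsDiscSemigroup F) {t : ℝ} (ht : 0 ≤ t) :
    InjOn (F t) (Metric.ball (0 : ℂ) 1) := by
  intro z hz w hw heq
  set K : Set ℂ := (fun s => F s z) '' Icc 0 t ∪ (fun s => F s w) '' Icc 0 t
  have hcont : ∀ {v}, v ∈ Metric.ball (0 : ℂ) 1 → ContinuousOn (fun s => F s v) (Icc 0 t) :=
    fun hv => (hF.continuousOn_orbit hv).mono Icc_subset_Ici_self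
  have hK : IsCompact K :=
    (isCompact_Icc.image_of_continuousOn (hcont hz)).union
      (isCompact_Icc.image_of_continuousOn (hcont hw))
  have hKball : K ⊆ Metric.ball 0 1 := by
    rintro _ (⟨s, hs, rfl⟩ | ⟨s, hs, rfl⟩)
    exacts [hF.mapsTo s hs.1 hz, hF.mapsTo s hs.1 hw]
  have hloc : LocallyLipschitzOn K (semigroupGenerator F) := fun v hv => by
    obtain ⟨L, U, hU, hL⟩ := hF.exists_lipschitz_nhds (hKball hv)
    exact ⟨L, U, mem_nhdsWithin_of_mem_nhds hU, hL⟩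
  obtain ⟨L, hL⟩ := hloc.exists_lipschitzOnWith_of_compact hK
  have := ODE_solution_unique_of_mem_Icc_left (v := fun _ => semigroupGenerator F)
    (s := fun _ => K) (fun _ _ => hL)
    (hcont hz) (fun s hs => hF.hasDerivWithinAt_orbit_left hz hs.1)
    (fun s hs => Or.inl ⟨s, Ioc_subset_Icc_self hs, rfl⟩)
    (hcont hw) (fun s hs => hF.hasDerivWithinAt_orbit_left hw hs.1)
    (fun s hs => Or.inr ⟨s, Ioc_subset_Icc_self hs, rfl⟩) heq (left_mem_Icc.2 ht)
  simpa [hF.zero_apply z hz, hF.zero_apply w hw] using this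

/-- Uniqueness on an interval on which the right-hand side is integrable. -/
theorem eqOn_of_intervalIntegrable (hF : IsDiscSemigroup F) (hz : z ∈ Metric.ball (0 : ℂ) 1)
    {γ : ℝ → ℂ}
    (hγ : ∀ t : ℝ, 0 ≤ t → γ t = z + ∫ s in (0 : ℝ)..t, semigroupGenerator F (γ s))
    {T : ℝ} (hT : 0 ≤ T)
    (hint : IntervalIntegrable (fun s => semigroupGenerator F (γ s)) volume 0 T) :
    EqOn γ (fun t => F t z) (Icc 0 T) := by
  have hγc : ContinuousOn γ (Icc 0 T) := by
    have := intervalIntegral.continuousOn_primitive_interval' hint left_mem_uIcc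
    rw [uIcc_of_le hT] at this
    exact (this.const_add z).congr fun t ht => hγ t ht.1
  have hFc : ContinuousOn (fun t => F t z) (Icc 0 T) :=
    (hF.continuousOn_orbit hz).mono Icc_subset_Ici_self
  refine IsClosed.Icc_subset_of_forall_mem_nhdsWithin (s := {t | γ t = F t z}) ?_ ?_ ?_
  · have := (hγc.prodMk hFc).preimage_isClosed_of_isClosed isClosed_Icc isClosed_diagonal
    rwa [inter_comm] at this
  · simp [hγ 0 le_rfl, hF.zero_apply z hz]
  rintro t ⟨hteq : γ t = F t z, ht⟩
  have hFt : F t z ∈ Metric.ball (0 : ℂ) 1 := hF.mapsTo t ht.1 hz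
  obtain ⟨L, U, hU, hL⟩ := hF.exists_lipschitz_nhds hFt
  set V := U ∩ Metric.ball 0 1
  have hV : V ∈ 𝓝 (F t z) := inter_mem hU (Metric.isOpen_ball.mem_nhds hFt)
  have hIcc : Icc 0 T ∈ 𝓝[≥] t := mem_of_superset (Icc_mem_nhdsGE ht.2) (Icc_subset_Icc_left ht.1)
  have hev : ∀ᶠ s in 𝓝[≥] t, s ∈ Icc 0 T ∧ γ s ∈ V ∧ F s z ∈ V := by
    have h1 : Tendsto γ (𝓝[≥] t) (𝓝 (F t z)) := by
      rw [← hteq]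
      exact (hγc t (Ico_subset_Icc_self ht)).mono_of_mem_nhdsWithin hIcc
    have h2 : Tendsto (fun s => F s z) (𝓝[≥] t) (𝓝 (F t z)) :=
      (hFc t (Ico_subset_Icc_self ht)).mono_of_mem_nhdsWithin hIcc
    exact (show ∀ᶠ s in 𝓝[≥] t, s ∈ Icc 0 T from hIcc).and ((h1.eventually hV).and (h2.eventually hV))
  obtain ⟨b, htb, hb⟩ := (mem_nhdsGE_iff_exists_Icc_subset).1 hev
  have hsub : Icc t b ⊆ Icc 0 T := fun s hs => (hb hs).1
  have hcomp : ContinuousOn (fun s => semigroupGenerator F (γ s)) (Icc t b) :=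
    hF.differentiableOn_generator.continuousOn.comp (hγc.mono hsub) fun s hs => (hb hs).2.1.2
  have hderiv : ∀ s ∈ Ico t b,
      HasDerivWithinAt γ (semigroupGenerator F (γ s)) (Ici s) s := by
    intro s hs
    have hs0 : 0 ≤ s := ht.1.trans hs.1
    have hmem : Icc t b ∈ 𝓝[>] s :=
      mem_of_superset (Icc_mem_nhdsGT hs.2) (Icc_subset_Icc_left hs.1)
    have hd : HasDerivWithinAt (fun u => ∫ x in (0 : ℝ)..u, semigroupGenerator F (γ x))
        (semigroupGenerator F (γ s)) (Ici s) s := by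
      refine intervalIntegral.integral_hasDerivWithinAt_right (t := Ioi s) ?_ ?_ ?_
      · refine hint.mono_set ?_
        rw [uIcc_of_le hs0, uIcc_of_le hT]
        exact Icc_subset_Icc_right (hsub (Ico_subset_Icc_self hs)).2
      · exact ⟨_, hmem, hcomp.aestronglyMeasurable measurableSet_Icc⟩
      · exact (hcomp s (Ico_subset_Icc_self hs)).mono_of_mem_nhdsWithin hmem
    exact (hd.const_add z).congr_of_mem (fun u (hu : s ≤ u) => hγ u (hs0.trans hu)) self_mem_Ici
  have heq := ODE_solution_unique_of_mem_Icc_right (v := fun _ => semigroupGenerator F)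
    (s := fun _ => V) (fun _ _ => hL.mono inter_subset_left)
    (hγc.mono hsub) hderiv (fun s hs => (hb (Ico_subset_Icc_self hs)).2.1)
    (hFc.mono hsub) (fun s hs => hF.hasDerivWithinAt_orbit hz (ht.1.trans hs.1))
    (fun s hs => (hb (Ico_subset_Icc_self hs)).2.2) hteq
  exact mem_of_superset (Icc_mem_nhdsGT htb) heq

/-- A solution of the integral equation has an integrable right-hand side: past the first time at
which integrability fails, the solution would be constant. -/
theorem intervalIntegrable_of_solution (hF : IsDiscSemigroup F)
    (hz : z ∈ Metric.ball (0 : ℂ) 1) {γ : ℝ → ℂ}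
    (hγ : ∀ t : ℝ, 0 ≤ t → γ t = z + ∫ s in (0 : ℝ)..t, semigroupGenerator F (γ s))
    {t : ℝ} (ht : 0 ≤ t) :
    IntervalIntegrable (fun s => semigroupGenerator F (γ s)) volume 0 t := by
  by_contra hnot
  set A : Set ℝ := {u | 0 ≤ u ∧
    IntervalIntegrable (fun s => semigroupGenerator F (γ s)) volume 0 u}
  have hA0 : (0 : ℝ) ∈ A := ⟨le_rfl, IntervalIntegrable.refl⟩
  have hmono : ∀ u ∈ A, ∀ v, 0 ≤ v → v ≤ u → v ∈ A := by
    rintro u ⟨hu, hui⟩ v hv hvu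
    refine ⟨hv, hui.mono_set ?_⟩
    rw [uIcc_of_le hv, uIcc_of_le hu]
    exact Icc_subset_Icc_right hvu
  have hbdd : BddAbove A := ⟨t, fun u hu => by
    by_contra! htu
    exact hnot (hmono u hu t ht htu.le).2⟩
  set T := sSup A
  have hT : 0 ≤ T := le_csSup hbdd hA0
  have hbelow : ∀ s ∈ Ico 0 T, γ s = F s z := by
    intro s hs
    obtain ⟨u, hu, hsu⟩ := exists_lt_of_lt_csSup ⟨0, hA0⟩ hs.2
    exact hF.eqOn_of_intervalIntegrable hz hγ hu.1 hu.2 ⟨hs.1, hsu.le⟩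
  have habove : ∀ s, T < s → γ s = z := by
    intro s hs
    have hs0 : 0 ≤ s := hT.trans hs.le
    rw [hγ s hs0, intervalIntegral.integral_undef, add_zero]
    exact fun hi => (le_csSup hbdd ⟨hs0, hi⟩).not_gt hs
  have hi1 : IntervalIntegrable (fun s => semigroupGenerator F (γ s)) volume 0 T := by
    refine (hF.intervalIntegrable_generator_orbit hz hT).congr_ae ?_
    rw [uIoc_of_le hT, ← restrict_Ioo_eq_restrict_Ioc]
    filter_upwards [ae_restrict_mem measurableSet_Ioo] with s hs
    rw [hbelow s (Ioo_subset_Ico_self hs)]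
  have hi2 : IntervalIntegrable (fun s => semigroupGenerator F (γ s)) volume T (T + 1) := by
    refine (intervalIntegrable_const (c := semigroupGenerator F z)).congr ?_
    intro s hs
    rw [uIoc_of_le (by linarith)] at hs
    simp only [habove s hs.1]
  have : T + 1 ≤ T := le_csSup hbdd ⟨by linarith, hi1.trans hi2⟩
  linarith

theorem solution_unique (hF : IsDiscSemigroup F) (hz : z ∈ Metric.ball (0 : ℂ) 1)
    {γ : ℝ → ℂ}
    (hγ : ∀ t : ℝ, 0 ≤ t → γ t = z + ∫ s in (0 : ℝ)..t, semigroupGenerator F (γ s))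
    {t : ℝ} (ht : 0 ≤ t) : γ t = F t z :=
  hF.eqOn_of_intervalIntegrable hz hγ ht (hF.intervalIntegrable_of_solution hz hγ ht)
    (right_mem_Icc.2 ht)

end IsDiscSemigroup

/-- Generator of a continuous one-parameter semigroup of holomorphic self-maps of the
unit disc: the generator exists as a locally uniform limit, is holomorphic, the
semigroup solves the corresponding integral (initial value) equation uniquely, and
every element of the semigroup is injective. -/
theorem continuous_semigroup_generator
    (F : ℝ → ℂ → ℂ)
    (hmaps : ∀ t, 0 ≤ t → Set.MapsTo (F t) (Metric.ball (0 : ℂ) 1) (Metric.ball (0 : ℂ) 1))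
    (hhol : ∀ t, 0 ≤ t → DifferentiableOn ℂ (F t) (Metric.ball (0 : ℂ) 1))
    (hid : ∀ z ∈ Metric.ball (0 : ℂ) 1, F 0 z = z)
    (hsemi : ∀ s t : ℝ, 0 ≤ s → 0 ≤ t →
      ∀ z ∈ Metric.ball (0 : ℂ) 1, F (t + s) z = F t (F s z))
    (hcont : ∀ t₀ : ℝ, 0 ≤ t₀ →
      TendstoLocallyUniformlyOn (fun t => F t) (F t₀)
        (nhdsWithin t₀ (Set.Ici 0)) (Metric.ball (0 : ℂ) 1)) :
    ∃ G : ℂ → ℂ,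
      DifferentiableOn ℂ G (Metric.ball (0 : ℂ) 1) ∧
      TendstoLocallyUniformlyOn (fun t z => (F t z - z) / (t : ℂ)) G
        (nhdsWithin 0 (Set.Ioi 0)) (Metric.ball (0 : ℂ) 1) ∧
      (∀ z ∈ Metric.ball (0 : ℂ) 1, ∀ t : ℝ, 0 ≤ t →
        F t z = z + ∫ s in (0 : ℝ)..t, G (F s z)) ∧
      (∀ z ∈ Metric.ball (0 : ℂ) 1, ∀ γ : ℝ → ℂ,
        (∀ t : ℝ, 0 ≤ t → γ t = z + ∫ s in (0 : ℝ)..t, G (γ s)) →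
        ∀ t : ℝ, 0 ≤ t → γ t = F t z) ∧
      (∀ t, 0 ≤ t → Set.InjOn (F t) (Metric.ball (0 : ℂ) 1)) := by
  have hF : IsDiscSemigroup F := ⟨hmaps, hhol, hid, hsemi, hcont⟩
  exact ⟨semigroupGenerator F, hF.differentiableOn_generator,
    hF.tendstoLocallyUniformlyOn_generator, fun z hz t ht => hF.eq_add_integral hz ht,
    fun z hz γ hγ t ht => hF.solution_unique hz hγ ht, fun t ht => hF.injOn ht⟩
end

section
/- Univalence of Loewner chain transition mappings: let D ⊊ ℂ be a simply connected domain and let (f_{s,t})_{0≤s≤t} be a family of nonconstant holomorphic self-maps of D such that f_{s,s} = id for all s ≥ 0, f_{s,u} = f_{s,t} ∘ f_{t,u} whenever 0 ≤ s ≤ t ≤ u, and (s,t) ↦ f_{s,t} is continuous with respect to locally uniform convergence on D. Then every f_{s,t} (in particular every f_{0,t}) is injective. -/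
open Filter Topology Set

/-- A holomorphic function within `R / 4` of the identity on a closed ball of radius `R` is
injective on the concentric ball of radius `R / 2`. -/
theorem injOn_ball_of_norm_sub_id_le {g : ℂ → ℂ} {p : ℂ} {R : ℝ} (hR : 0 < R) {D : Set ℂ}
    (hopen : IsOpen D) (hD : Metric.closedBall p R ⊆ D) (hg : DifferentiableOn ℂ g D)
    (hb : ∀ z ∈ Metric.closedBall p R, ‖g z - z‖ ≤ R / 4) :
    InjOn g (Metric.ball p (R / 2)) := by
  have hd : DifferentiableOn ℂ (fun z => g z - z) D := hg.sub differentiableOn_id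
  have hsub : ∀ z ∈ Metric.ball p (R / 2), Metric.closedBall z (R / 2) ⊆ Metric.closedBall p R :=
    fun z hz => Metric.closedBall_subset_closedBall' (by linarith [Metric.mem_ball.1 hz])
  have hmem : ∀ z ∈ Metric.ball p (R / 2), z ∈ D := fun z hz =>
    hD (hsub z hz (Metric.mem_closedBall_self (by linarith)))
  have hderiv : ∀ z ∈ Metric.ball p (R / 2), ‖deriv (fun z => g z - z) z‖ ≤ 1 / 2 := by
    intro z hz
    have h := Complex.norm_deriv_le_of_forall_mem_sphere_norm_le (c := z) (R := R / 2)
      (C := R / 4) (f := fun z => g z - z) (by linarith)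
      ((hd.mono ((hsub z hz).trans hD)).diffContOnCl_ball subset_rfl)
      (fun x hx => hb x (hsub z hz (Metric.sphere_subset_closedBall hx)))
    calc _ ≤ R / 4 / (R / 2) := h
      _ = 1 / 2 := by field_simp; norm_num
  intro z hz w hw hzw
  have h := (convex_ball p (R / 2)).norm_image_sub_le_of_norm_deriv_le
    (fun x hx => hd.differentiableAt (hopen.mem_nhds (hmem x hx))) hderiv hz hw
  have he : g w - w - (g z - z) = -(w - z) := by rw [hzw]; ring
  rw [he, norm_neg] at h
  have h0 : ‖w - z‖ = 0 := by linarith [norm_nonneg (w - z)]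
  exact (sub_eq_zero.1 (norm_eq_zero.1 h0)).symm

/-- Univalence of Loewner chain transition mappings: every transition mapping of a
(decreasing) Loewner chain on a simply connected domain D ⊊ ℂ is injective. -/
theorem loewner_transition_maps_univalent
    (D : Set ℂ) (hne : D ≠ Set.univ) (hopen : IsOpen D) (hconn : IsConnected D)
    (hsc : SimplyConnectedSpace D)
    (f : ℝ → ℝ → ℂ → ℂ)
    (hmaps : ∀ s t : ℝ, 0 ≤ s → s ≤ t → Set.MapsTo (f s t) D D)
    (hhol : ∀ s t : ℝ, 0 ≤ s → s ≤ t → DifferentiableOn ℂ (f s t) D)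
    (hnc : ∀ s t : ℝ, 0 ≤ s → s ≤ t → ¬ ∃ c : ℂ, Set.EqOn (f s t) (fun _ => c) D)
    (hid : ∀ s : ℝ, 0 ≤ s → ∀ z ∈ D, f s s z = z)
    (hcomp : ∀ s t u : ℝ, 0 ≤ s → s ≤ t → t ≤ u → ∀ z ∈ D, f s u z = f s t (f t u z))
    (hcont : ∀ s₀ t₀ : ℝ, 0 ≤ s₀ → s₀ ≤ t₀ →
      TendstoLocallyUniformlyOn (fun q : ℝ × ℝ => f q.1 q.2) (f s₀ t₀)
        (nhdsWithin (s₀, t₀) {q : ℝ × ℝ | 0 ≤ q.1 ∧ q.1 ≤ q.2}) D) :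
    ∀ s t : ℝ, 0 ≤ s → s ≤ t → Set.InjOn (f s t) D := by
  intro s T hs hsT z hz w hw hzw
  have hcts : ∀ x ∈ D, ContinuousOn (fun t => f t T x) (Icc s T) := by
    intro x hx t ht
    refine Tendsto.comp (f := fun r => (r, T))
      ((hcont t T (hs.trans ht.1) ht.2).tendsto_at hx) ?_
    refine tendsto_nhdsWithin_of_tendsto_nhds_of_eventually_within _ ?_ ?_
    · exact (Continuous.prodMk_left T).continuousAt.tendsto.mono_left nhdsWithin_le_nhds
    · filter_upwards [self_mem_nhdsWithin] with r hr using ⟨hs.trans hr.1, hr.2⟩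
  -- the last time at which the two trajectories coincide
  let S : Set ℝ := {t | t ∈ Icc s T ∧ f t T z = f t T w}
  have hScl : IsClosed S := by
    have h := ((hcts z hz).sub (hcts w hw)).preimage_isClosed_of_isClosed isClosed_Icc
      (isClosed_singleton (x := (0 : ℂ)))
    convert h using 1
    ext t
    simp [S, sub_eq_zero]
  have hScomp : IsCompact S := isCompact_Icc.of_isClosed_subset hScl fun t ht => ht.1
  have hτS : sSup S ∈ S := hScomp.sSup_mem ⟨s, ⟨le_rfl, hsT⟩, hzw⟩
  have hmax : ∀ t ∈ S, t ≤ sSup S := fun t ht => le_csSup hScomp.bddAbove ht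
  generalize sSup S = τ at hτS hmax
  obtain ⟨⟨hsτ, hτT⟩, heq⟩ := hτS
  have hτ0 : 0 ≤ τ := hs.trans hsτ
  rcases hτT.eq_or_lt with rfl | hlt
  · rwa [hid τ hτ0 z hz, hid τ hτ0 w hw] at heq
  exfalso
  have hpD : f τ T z ∈ D := hmaps τ T hτ0 hτT hz
  have hle : 𝓝[>] τ ≤ 𝓝[Icc s T] τ := by
    rw [← nhdsWithin_Ioc_eq_nhdsGT hlt]
    exact nhdsWithin_mono _ fun t ht => ⟨hsτ.trans ht.1.le, ht.2⟩
  have hzt : Tendsto (fun t => f t T z) (𝓝[>] τ) (𝓝 (f τ T z)) :=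
    (hcts z hz τ ⟨hsτ, hτT⟩).tendsto.mono_left hle
  have hwt : Tendsto (fun t => f t T w) (𝓝[>] τ) (𝓝 (f τ T z)) :=
    heq ▸ (hcts w hw τ ⟨hsτ, hτT⟩).tendsto.mono_left hle
  obtain ⟨R, hR, hRD⟩ := Metric.nhds_basis_closedBall.mem_iff.1 (hopen.mem_nhds hpD)
  have hunif := (tendstoLocallyUniformlyOn_iff_forall_isCompact hopen).1
    (hcont τ τ hτ0 le_rfl) _ hRD (isCompact_closedBall _ _)
  have hpair : Tendsto (fun t => (τ, t)) (𝓝[>] τ)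
      (𝓝[{q : ℝ × ℝ | 0 ≤ q.1 ∧ q.1 ≤ q.2}] (τ, τ)) := by
    refine tendsto_nhdsWithin_of_tendsto_nhds_of_eventually_within _ ?_ ?_
    · exact (Continuous.prodMk_right τ).continuousAt.tendsto.mono_left nhdsWithin_le_nhds
    · filter_upwards [self_mem_nhdsWithin] with r hr using ⟨hτ0, le_of_lt hr⟩
  have hclose := hpair.eventually (Metric.tendstoUniformlyOn_iff.1 hunif (R / 4) (by linarith))
  obtain ⟨t, hfar, hzb, hwb, htτ, htT⟩ := (hclose.and
    ((hzt.eventually (Metric.ball_mem_nhds _ (half_pos hR))).and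
    ((hwt.eventually (Metric.ball_mem_nhds _ (half_pos hR))).and
    (Ioc_mem_nhdsGT hlt)))).exists
  have hinj : InjOn (f τ t) (Metric.ball (f τ T z) (R / 2)) := by
    refine injOn_ball_of_norm_sub_id_le hR hopen hRD (hhol τ t hτ0 htτ.le) fun x hx => ?_
    have h := hfar x hx
    rw [hid τ hτ0 x (hRD hx), dist_comm, dist_eq_norm] at h
    exact h.le
  have hcoll : f t T z = f t T w := hinj hzb hwb <| by
    rw [← hcomp τ t T hτ0 htτ.le htT z hz, ← hcomp τ t T hτ0 htτ.le htT w hw, heq]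
  exact htτ.not_ge (hmax t ⟨⟨hsτ.trans htτ.le, htT⟩, hcoll⟩)
end

section
/- Nonlinear resolvents form a decreasing chain of univalent maps: let D ⊂ ℂ be a bounded convex domain and let G : D → ℂ be holomorphic such that for every t ≥ 0 and every w ∈ D the equation w = z − t·G(z) has a unique solution z ∈ D; denote this solution by J_t(w). Then each J_t : D → D is a holomorphic injective map, t ↦ J_t is continuous with respect to locally uniform convergence, ∂_t J_t(w) = J_t′(w)·G(J_t(w)) for all t ≥ 0 and w ∈ D, J_t(D) ⊆ J_s(D) whenever 0 ≤ s ≤ t, and ⋂_{t≥0} J_t(D) = {z ∈ D : G(z) = 0}. -/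
open Filter Topology Set

/-- A holomorphic injective function on an open subset of the plane has nonvanishing derivative. -/
theorem deriv_ne_zero_of_differentiableOn_of_injOn {f : ℂ → ℂ} {U : Set ℂ} (hU : IsOpen U)
    (hf : DifferentiableOn ℂ f U) (hinj : InjOn f U) {z₀ : ℂ} (hz₀ : z₀ ∈ U) :
    deriv f z₀ ≠ 0 := by
  have hopenMap : ∀ z ∈ U, 𝓝 (f z) ≤ map f (𝓝 z) := fun z hz => by
    refine ((hf.analyticAt (hU.mem_nhds hz)).eventually_constant_or_nhds_le_map_nhds).resolve_left
      fun hconst => ?_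
    obtain ⟨y, ⟨hy, hyU⟩, hne⟩ := ((eventually_nhdsWithin_of_eventually_nhds
      (hconst.and (hU.eventually_mem hz))).and (eventually_mem_nhdsWithin (a := z) (s := {z}ᶜ))).exists
    exact hne (hinj hyU hz hy)
  have hleft : ∀ z ∈ U, ∀ᶠ x in 𝓝 z, Function.invFunOn f U (f x) = x := fun z hz => by
    filter_upwards [hU.mem_nhds hz] with x hx using hinj.leftInvOn_invFunOn hx
  have hright : ∀ z ∈ U, ∀ᶠ v in 𝓝 (f z), f (Function.invFunOn f U v) = v := fun z hz => by
    refine Eventually.filter_mono (hopenMap z hz) (eventually_map.2 ?_)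
    filter_upwards [hleft z hz] with x hx
    rw [hx]
  have hcont : ∀ z ∈ U, ContinuousAt (Function.invFunOn f U) (f z) := fun z hz => by
    have h : Tendsto (Function.invFunOn f U) (map f (𝓝 z)) (𝓝 z) :=
      tendsto_map'_iff.2 (tendsto_id.congr' ((hleft z hz).mono fun x hx => hx.symm))
    rw [ContinuousAt, (hleft z hz).self_of_nhds]
    exact h.mono_left (hopenMap z hz)
  have hderiv : ∀ᶠ z in 𝓝[≠] z₀, deriv f z ≠ 0 := by
    refine ((hf.analyticAt (hU.mem_nhds hz₀)).deriv.eventually_eq_zero_or_eventually_ne_zero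
      ).resolve_left fun hzero => ?_
    obtain ⟨r, hr, hball⟩ := Metric.eventually_nhds_iff_ball.1
      (hzero.and (hU.eventually_mem hz₀))
    obtain ⟨y, hy, hne⟩ := ((eventually_nhdsWithin_of_eventually_nhds
      (Metric.ball_mem_nhds z₀ hr)).and (eventually_mem_nhdsWithin (a := z₀) (s := {z₀}ᶜ))).exists
    refine hne (hinj (hball y hy).2 hz₀ ?_)
    exact Metric.isOpen_ball.is_const_of_deriv_eq_zero
      (convex_ball z₀ r).isPreconnected (hf.mono fun x hx => (hball x hx).2)
      (fun x hx => (hball x hx).1) hy (Metric.mem_ball_self hr)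
  have hpunct : ∀ᶠ v in 𝓝[≠] (f z₀), DifferentiableAt ℂ (Function.invFunOn f U) v := by
    rw [eventually_nhdsWithin_iff] at hderiv ⊢
    refine Eventually.filter_mono (hopenMap z₀ hz₀) (eventually_map.2 ?_)
    filter_upwards [hderiv, hU.mem_nhds hz₀] with x hx hxU hne
    have hd : HasDerivAt f (deriv f x) (Function.invFunOn f U (f x)) := by
      rw [hinj.leftInvOn_invFunOn hxU]
      exact (hf.differentiableAt (hU.mem_nhds hxU)).hasDerivAt
    exact (hd.of_local_left_inverse (hcont x hxU) (hx fun h => hne (congrArg f h))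
      (hright x hxU)).differentiableAt
  have hg : DifferentiableAt ℂ (Function.invFunOn f U) (f z₀) :=
    (Complex.analyticAt_of_differentiable_on_punctured_nhds_of_continuousAt hpunct
      (hcont z₀ hz₀)).differentiableAt
  have hcomp := (hg.hasDerivAt.comp z₀
    (hf.differentiableAt (hU.mem_nhds hz₀)).hasDerivAt).congr_of_eventuallyEq
    ((hleft z₀ hz₀).mono fun x hx => hx.symm)
  intro h
  rw [h, mul_zero] at hcomp
  exact zero_ne_one (hcomp.unique (hasDerivAt_id z₀))

/-- Where `1 - t₀ * deriv G z₀ ≠ 0`, the equation `w = z - t G(z)` has a local solution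
depending holomorphically on `(t, w)`. -/
theorem exists_differentiableAt_local_resolvent {D : Set ℂ} (hD : IsOpen D) {G : ℂ → ℂ}
    (hG : DifferentiableOn ℂ G D) {t₀ z₀ : ℂ} (hz₀ : z₀ ∈ D) (hne : 1 - t₀ * deriv G z₀ ≠ 0) :
    ∃ ψ : ℂ × ℂ → ℂ, DifferentiableAt ℂ ψ (t₀, z₀ - t₀ * G z₀) ∧
      ∀ᶠ p in 𝓝 (t₀, z₀ - t₀ * G z₀), ψ p ∈ D ∧ p.2 = ψ p - p.1 * G (ψ p) := by
  have hGs : HasStrictDerivAt G (deriv G z₀) z₀ :=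
    (hG.analyticAt (hD.mem_nhds hz₀)).hasStrictDerivAt
  set u : (ℂ × ℂ) × ℂ := ((t₀, z₀ - t₀ * G z₀), z₀) with hu
  have hsnd : HasStrictFDerivAt (fun v : (ℂ × ℂ) × ℂ => v.2) (.snd ℂ (ℂ × ℂ) ℂ) u :=
    hasStrictFDerivAt_snd
  have hfst : HasStrictFDerivAt (fun v : (ℂ × ℂ) × ℂ => v.1) (.fst ℂ (ℂ × ℂ) ℂ) u :=
    hasStrictFDerivAt_fst
  have hGu : HasStrictFDerivAt (fun v : (ℂ × ℂ) × ℂ => G v.2)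
      (deriv G z₀ • .snd ℂ (ℂ × ℂ) ℂ) u := hGs.comp_hasStrictFDerivAt u hsnd
  have hf := (hsnd.sub (hfst.fst.mul hGu)).sub hfst.snd
  suffices hinv : (_ ∘L ContinuousLinearMap.inr ℂ (ℂ × ℂ) ℂ).IsInvertible by
    refine ⟨hf.implicitFunctionOfProdDomain hinv,
      (hf.hasStrictFDerivAt_implicitFunctionOfProdDomain hinv).hasFDerivAt.differentiableAt, ?_⟩
    filter_upwards [hf.eventually_apply_implicitFunctionOfProdDomain hinv,
      (hf.tendsto_implicitFunctionOfProdDomain hinv) (hD.mem_nhds hz₀)] with p hp hpD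
    refine ⟨hpD, ?_⟩
    simp [hu] at hp
    linear_combination -hp
  · refine ⟨ContinuousLinearEquiv.unitsEquivAut ℂ (Units.mk0 _ hne), ?_⟩
    ext
    simp [hu]

/-- Nonlinear resolvents of an infinitesimal generator on a bounded convex domain form a
decreasing Loewner chain of univalent maps, satisfy the Loewner PDE, and their images
contract to the zero set of the generator. -/
theorem nonlinear_resolvents_decreasing_chain
    (D : Set ℂ) (hopen : IsOpen D) (hconn : IsConnected D)
    (hbdd : Bornology.IsBounded D) (hconv : Convex ℝ D)
    (G : ℂ → ℂ) (hG : DifferentiableOn ℂ G D)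
    (J : ℝ → ℂ → ℂ)
    (hJ : ∀ t : ℝ, 0 ≤ t → ∀ w ∈ D, J t w ∈ D ∧ w = J t w - (t : ℂ) * G (J t w))
    (hJuniq : ∀ t : ℝ, 0 ≤ t → ∀ w ∈ D, ∀ z ∈ D, w = z - (t : ℂ) * G z → z = J t w) :
    (∀ t : ℝ, 0 ≤ t →
      DifferentiableOn ℂ (J t) D ∧ Set.InjOn (J t) D ∧ Set.MapsTo (J t) D D) ∧
    (∀ t₀ : ℝ, 0 ≤ t₀ →
      TendstoLocallyUniformlyOn (fun t => J t) (J t₀) (nhdsWithin t₀ (Set.Ici 0)) D) ∧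
    (∀ t : ℝ, 0 ≤ t → ∀ w ∈ D,
      HasDerivWithinAt (fun τ : ℝ => J τ w) (deriv (J t) w * G (J t w)) (Set.Ici 0) t) ∧
    (∀ s t : ℝ, 0 ≤ s → s ≤ t → J t '' D ⊆ J s '' D) ∧
    (⋂ t ∈ Set.Ici (0 : ℝ), J t '' D) = {z ∈ D | G z = 0} := by
  have hdiff (t : ℝ) : DifferentiableOn ℂ (fun z => z - (t : ℂ) * G z) D :=
    differentiableOn_id.sub (hG.const_mul _)
  have hGd (z : ℂ) (hz : z ∈ D) : HasDerivAt G (deriv G z) z :=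
    (hG.differentiableAt (hopen.mem_nhds hz)).hasDerivAt
  have hne : ∀ t : ℝ, 0 ≤ t → ∀ w ∈ D, 1 - (t : ℂ) * deriv G (J t w) ≠ 0 := by
    intro t ht w hw
    obtain ⟨hmem, heq⟩ := hJ t ht w hw
    have h := deriv_ne_zero_of_differentiableOn_of_injOn
      ((hdiff t).continuousOn.isOpen_inter_preimage hopen hopen)
      ((hdiff t).mono inter_subset_left)
      (fun x hx y hy hxy => (hJuniq t ht _ hx.2 x hx.1 rfl).trans
        (hJuniq t ht _ hx.2 y hy.1 hxy).symm)
      (z₀ := J t w) ⟨hmem, by rw [mem_preimage, ← heq]; exact hw⟩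
    have hF : HasDerivAt (fun z => z - (t : ℂ) * G z) (1 - (t : ℂ) * deriv G (J t w)) (J t w) :=
      (hasDerivAt_id' _).sub ((hGd _ hmem).const_mul _)
    rwa [hF.deriv] at h
  have hlocal : ∀ t : ℝ, 0 ≤ t → ∀ w ∈ D, ∃ ψ : ℂ × ℂ → ℂ,
      DifferentiableAt ℂ ψ ((t : ℂ), w) ∧
        ∀ᶠ p : ℝ × ℂ in 𝓝 (t, w), 0 ≤ p.1 → J p.1 p.2 = ψ (p.1, p.2) := by
    intro t ht w hw
    obtain ⟨hmem, heq⟩ := hJ t ht w hw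
    obtain ⟨ψ, hψ, hev⟩ :=
      exists_differentiableAt_local_resolvent hopen hG hmem (hne t ht w hw)
    rw [← heq] at hψ hev
    refine ⟨ψ, hψ, ?_⟩
    have hcast : Tendsto (fun p : ℝ × ℂ => ((p.1 : ℂ), p.2)) (𝓝 (t, w)) (𝓝 ((t : ℂ), w)) :=
      Continuous.tendsto (by fun_prop) (t, w)
    filter_upwards [hcast.eventually hev,
      continuous_snd.continuousAt.eventually (hopen.mem_nhds hw)] with p hp hpD hp0
    exact (hJuniq p.1 hp0 p.2 hpD _ hp.1 hp.2).symm
  have hJdiff : ∀ t : ℝ, 0 ≤ t → ∀ w ∈ D, DifferentiableAt ℂ (J t) w := by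
    intro t ht w hw
    obtain ⟨ψ, hψ, hev⟩ := hlocal t ht w hw
    have hcurve : DifferentiableAt ℂ (fun v : ℂ => ψ ((t : ℂ), v)) w :=
      DifferentiableAt.comp (f := fun v : ℂ => ((t : ℂ), v)) w hψ (by fun_prop)
    refine hcurve.congr_of_eventuallyEq ?_
    have hpair : Tendsto (fun v : ℂ => (t, v)) (𝓝 w) (𝓝 (t, w)) :=
      Continuous.tendsto (by fun_prop) w
    filter_upwards [hpair.eventually hev] with v hv using hv ht
  refine ⟨fun t ht => ⟨fun w hw => (hJdiff t ht w hw).differentiableWithinAt,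
    fun x hx y hy hxy => ?_, fun w hw => (hJ t ht w hw).1⟩, fun t₀ ht₀ => ?_,
    fun t ht w hw => ?_, ?_, ?_⟩
  · rw [(hJ t ht x hx).2, (hJ t ht y hy).2, hxy]
  · rw [Metric.tendstoLocallyUniformlyOn_iff]
    intro ε hε w hw
    obtain ⟨ψ, hψ, hev⟩ := hlocal t₀ ht₀ w hw
    have hcast : ContinuousAt (fun p : ℝ × ℂ => ψ ((p.1 : ℂ), p.2)) (t₀, w) :=
      ContinuousAt.comp (f := fun p : ℝ × ℂ => ((p.1 : ℂ), p.2)) hψ.continuousAt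
        (Continuous.continuousAt (by fun_prop))
    have hclose := hev.and (hcast (Metric.ball_mem_nhds _ (half_pos hε)))
    rw [nhds_prod_eq] at hclose
    obtain ⟨P, hP, Q, hQ, hPQ⟩ := eventually_prod_iff.1 hclose
    refine ⟨{v | Q v}, mem_nhdsWithin_of_mem_nhds hQ, ?_⟩
    filter_upwards [mem_nhdsWithin_of_mem_nhds hP, self_mem_nhdsWithin] with t htP ht v hv
    obtain ⟨heq, hdist⟩ := hPQ htP hv
    obtain ⟨heq₀, hdist₀⟩ := hPQ hP.self_of_nhds hv
    simp only [Metric.mem_ball] at hdist hdist₀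
    rw [heq ht, heq₀ ht₀]
    linarith [dist_triangle_right (ψ ((t₀ : ℂ), v)) (ψ ((t : ℂ), v)) (ψ ((t₀ : ℂ), w))]
  · obtain ⟨ψ, hψ, hev⟩ := hlocal t ht w hw
    obtain ⟨hmem, heq⟩ := hJ t ht w hw
    have hcurve : DifferentiableAt ℝ (fun τ : ℝ => ψ ((τ : ℂ), w)) t :=
      DifferentiableAt.comp (f := fun τ : ℝ => ((τ : ℂ), w)) t (hψ.restrictScalars ℝ)
        (Complex.ofRealCLM.differentiableAt.prodMk (differentiableAt_const w))
    have hpair : Tendsto (fun τ : ℝ => (τ, w)) (𝓝 t) (𝓝 (t, w)) :=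
      Continuous.tendsto (by fun_prop) t
    have hdt : DifferentiableWithinAt ℝ (fun τ : ℝ => J τ w) (Ici 0) t := by
      refine hcurve.differentiableWithinAt.congr_of_eventuallyEq ?_
        ((hpair.eventually hev).self_of_nhds ht)
      filter_upwards [mem_nhdsWithin_of_mem_nhds (hpair.eventually hev), self_mem_nhdsWithin]
        with τ hτ hτ0 using hτ hτ0
    have ha := hdt.hasDerivWithinAt
    have hb := (hJdiff t ht w hw).hasDerivAt
    set a := derivWithin (fun τ : ℝ => J τ w) (Ici 0) t
    set b := deriv (J t) w
    have haeq : a - (G (J t w) + (t : ℂ) * (deriv G (J t w) * a)) = 0 := by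
      have hid : HasDerivWithinAt (fun τ : ℝ => (τ : ℂ)) 1 (Ici 0) t :=
        (hasDerivAt_id t).ofReal_comp.hasDerivWithinAt
      have h := ha.sub (hid.mul ((hGd _ hmem).comp_hasDerivWithinAt t ha))
      have hc : HasDerivWithinAt (fun _ : ℝ => w) 0 (Ici 0) t := hasDerivWithinAt_const ..
      have h' := hc.congr (fun τ hτ => ((hJ τ hτ w hw).2).symm) heq.symm
      simpa using (uniqueDiffOn_Ici (0 : ℝ) t ht).eq_deriv _ h h'
    have hbeq : b - (t : ℂ) * (deriv G (J t w) * b) = 1 := by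
      have h := hb.sub (((hGd _ hmem).comp w hb).const_mul (t : ℂ))
      refine h.unique ((hasDerivAt_id' w).congr_of_eventuallyEq ?_)
      filter_upwards [hopen.mem_nhds hw] with v hv using ((hJ t ht v hv).2).symm
    have hab : a = b * G (J t w) := by linear_combination b * haeq - a * hbeq
    rwa [← hab]
  · rintro s t hs hst _ ⟨w, hw, rfl⟩
    have ht := hs.trans hst
    obtain ⟨hmem, heq⟩ := hJ t ht w hw
    rcases ht.eq_or_lt with rfl | htpos
    · rw [le_antisymm hst hs]
      exact mem_image_of_mem _ hw
    · have htc : (t : ℂ) ≠ 0 := by exact_mod_cast htpos.ne'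
      have hmix : J t w - (s : ℂ) * G (J t w) ∈ D := by
        convert hconv hmem hw (sub_nonneg.2 ((div_le_one htpos).2 hst))
          (div_nonneg hs ht) (sub_add_cancel 1 (s / t)) using 1
        simp only [Complex.real_smul]
        push_cast
        field_simp
        linear_combination -(s : ℂ) * heq
      exact ⟨_, hmix, (hJuniq s hs _ hmix _ hmem rfl).symm⟩
  · ext z
    simp only [mem_iInter, mem_Ici, mem_ofPred_eq]
    constructor
    · intro h
      have hD : ∀ t : ℝ, 0 ≤ t → z ∈ D ∧ z - (t : ℂ) * G z ∈ D := by
        intro t ht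
        obtain ⟨w, hw, rfl⟩ := h t ht
        exact ⟨(hJ t ht w hw).1, by rw [← (hJ t ht w hw).2]; exact hw⟩
      refine ⟨(hD 0 le_rfl).1, ?_⟩
      by_contra hGz
      have hpos : 0 < ‖G z‖ := norm_pos_iff.2 hGz
      obtain ⟨C, hC⟩ := Metric.isBounded_iff.1 hbdd
      have hC0 : 0 ≤ C := dist_nonneg.trans (hC (hD 0 le_rfl).1 (hD 0 le_rfl).1)
      have ht : 0 ≤ (C + 1) / ‖G z‖ := by positivity
      have hle := hC (hD 0 le_rfl).1 (hD _ ht).2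
      rw [dist_eq_norm, sub_sub_cancel, norm_mul, Complex.norm_of_nonneg ht,
        div_mul_cancel₀ _ hpos.ne'] at hle
      linarith
    · rintro ⟨hz, hGz⟩ t ht
      exact ⟨z, hz, (hJuniq t ht z hz z hz (by simp [hGz])).symm⟩
end

section
/- Bieberbach's theorem: let f : 𝔻 → ℂ be an injective holomorphic function with f(0) = 0 and f′(0) = 1, with power series f(z) = z + Σ_{n≥2} a_n zⁿ. Then |a₂| ≤ 2, and equality |a₂| = 2 holds if and only if there exists α ∈ ℝ such that f(z) = z/(1 − e^{iα} z)² for all z ∈ 𝔻. -/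
open Filter Topology Set
open MeasureTheory Metric
open scoped Real

/-- The open annulus `{z : r < ‖z‖ < ρ}` centred at the origin. -/
def annulus (r ρ : ℝ) : Set ℂ := {z | r < ‖z‖ ∧ ‖z‖ < ρ}

theorem isOpen_annulus (r ρ : ℝ) : IsOpen (annulus r ρ) :=
  (isOpen_lt continuous_const continuous_norm).inter (isOpen_lt continuous_norm continuous_const)

/-- Integration over an annulus in polar coordinates. -/
theorem integral_annulus {E : Type*} [NormedAddCommGroup E] [NormedSpace ℝ E]
    {r ρ : ℝ} (hr : 0 < r) {G : ℂ → E}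
    (hG : ContinuousOn G {z | r ≤ ‖z‖ ∧ ‖z‖ ≤ ρ}) :
    ∫ z in annulus r ρ, G z = ∫ t in Ioo r ρ, (2 * π * t) • Real.circleAverage G 0 t := by
  have hpolar : ∀ p : ℝ × ℝ, Complex.polarCoord.symm p = circleMap 0 p.1 p.2 := by
    intro p
    rw [Complex.polarCoord_symm_apply, circleMap, Complex.exp_mul_I]
    simp
  have hcont : ContinuousOn (fun p : ℝ × ℝ => p.1 • G (circleMap 0 p.1 p.2))
      (Icc r ρ ×ˢ Icc (-π) π) := by
    refine continuousOn_fst.smul (hG.comp ?_ ?_)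
    · unfold circleMap
      fun_prop
    · rintro ⟨t, θ⟩ ⟨ht, -⟩
      have ht0 : 0 ≤ t := hr.le.trans ht.1
      simpa [abs_of_nonneg ht0] using ht
  have hint : IntegrableOn (fun p : ℝ × ℝ => p.1 • G (circleMap 0 p.1 p.2))
      (Ioo r ρ ×ˢ Ioo (-π) π) (volume.prod volume) :=
    (hcont.integrableOn_compact (μ := volume.prod volume)
      (isCompact_Icc.prod isCompact_Icc)).mono_set
      (prod_mono Ioo_subset_Icc_self Ioo_subset_Icc_self)
  have hind : ∀ p ∈ polarCoord.target,
      p.1 • (annulus r ρ).indicator G (Complex.polarCoord.symm p) =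
      (Ioo r ρ ×ˢ Ioo (-π) π).indicator (fun p : ℝ × ℝ => p.1 • G (circleMap 0 p.1 p.2)) p := by
    rintro ⟨t, θ⟩ hp
    obtain ⟨ht : 0 < t, hθ⟩ : 0 < t ∧ θ ∈ Ioo (-π) π := by simpa [polarCoord_target] using hp
    rw [hpolar]
    by_cases h : t ∈ Ioo r ρ
    · rw [indicator_of_mem, indicator_of_mem]
      · exact ⟨h, hθ⟩
      · simpa [annulus, abs_of_pos ht] using h
    · rw [indicator_of_notMem, indicator_of_notMem, smul_zero]
      · exact fun hh => h hh.1
      · simpa [annulus, abs_of_pos ht] using h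
  have hsub : Ioo r ρ ×ˢ Ioo (-π) π ⊆ polarCoord.target := by
    rw [polarCoord_target]
    exact prod_mono (fun t ht => hr.trans ht.1) subset_rfl
  have hms : MeasurableSet (Ioo r ρ ×ˢ Ioo (-π) π) := measurableSet_Ioo.prod measurableSet_Ioo
  rw [← integral_indicator (isOpen_annulus r ρ).measurableSet,
    ← Complex.integral_comp_polarCoord_symm,
    setIntegral_congr_fun polarCoord.open_target.measurableSet hind,
    setIntegral_indicator hms, inter_eq_self_of_subset_right hsub, Measure.volume_eq_prod,
    setIntegral_prod _ hint]
  refine setIntegral_congr_fun measurableSet_Ioo fun t _ => ?_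
  have hper : Function.Periodic (fun θ => G (circleMap 0 t θ)) (2 * π) :=
    fun θ => by simp only [periodic_circleMap 0 t θ]
  have hθ := hper.intervalIntegral_add_eq (-π) 0
  rw [show -π + 2 * π = π by ring, zero_add] at hθ
  simp only
  rw [integral_smul, ← integral_Ioc_eq_integral_Ioo,
    ← intervalIntegral.integral_of_le (by linarith [Real.pi_pos]), hθ,
    Real.circleAverage_def, smul_smul]
  congr 1
  field_simp

theorem det_id_sub_smul_conj (c : ℂ) :
    LinearMap.det (LinearMap.id - (LinearMap.mulLeft ℝ c) ∘ₗ
      Complex.conjAe.toLinearMap : ℂ →ₗ[ℝ] ℂ) = 1 - ‖c‖ ^ 2 := by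
  rw [← LinearMap.det_toMatrix Complex.basisOneI, Matrix.det_fin_two, ← Complex.normSq_eq_norm_sq,
    Complex.normSq_apply]
  simp [LinearMap.toMatrix_apply]
  ring

/-- The area of a filled ellipse, presented as the preimage of a disc under `w ↦ w - c * conj w`. -/
theorem volume_norm_sub_mul_conj_le {c : ℂ} (hc : ‖c‖ < 1) {M : ℝ} (hM : 0 ≤ M) :
    volume {w : ℂ | ‖w - c * (starRingEnd ℂ) w‖ ≤ M} =
      ENNReal.ofReal (π * M ^ 2 / (1 - ‖c‖ ^ 2)) := by
  have hpos : 0 < 1 - ‖c‖ ^ 2 := by nlinarith [norm_nonneg c]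
  have hset : {w : ℂ | ‖w - c * (starRingEnd ℂ) w‖ ≤ M} =
      (LinearMap.id - (LinearMap.mulLeft ℝ c) ∘ₗ Complex.conjAe.toLinearMap : ℂ →ₗ[ℝ] ℂ) ⁻¹'
        closedBall 0 M := by
    ext w
    simp
  rw [hset, Measure.addHaar_preimage_linearMap _ (by rw [det_id_sub_smul_conj]; exact hpos.ne'),
    det_id_sub_smul_conj, Complex.volume_closedBall, abs_of_pos (by positivity),
    ← ENNReal.ofReal_pow hM, ← ENNReal.ofReal_coe_nnreal, NNReal.coe_real_pi,
    ← ENNReal.ofReal_mul (by positivity), ← ENNReal.ofReal_mul (by positivity)]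
  congr 1
  field_simp

theorem volume_image_of_hasDerivAt {s : Set ℂ} (hs : MeasurableSet s) {φ φ' : ℂ → ℂ}
    (hφ : ∀ z ∈ s, HasDerivAt φ (φ' z) z) (hinj : InjOn φ s) :
    volume (φ '' s) = ∫⁻ z in s, ENNReal.ofReal (‖φ' z‖ ^ 2) := by
  rw [← lintegral_abs_det_fderiv_eq_addHaar_image volume hs
    (fun z hz => ((hφ z hz).hasFDerivAt.restrictScalars ℝ).hasFDerivWithinAt) hinj]
  simp [ContinuousLinearMap.det, LinearMap.det_restrictScalars,
      Algebra.norm_complex_eq, Complex.normSq_eq_norm_sq]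

theorem circleAverage_norm_sq_sub_inv_sq {η : ℂ → ℂ} (hη : DifferentiableOn ℂ η (ball 0 1))
    {t : ℝ} (ht : 0 < t) (ht1 : t < 1) :
    Real.circleAverage (fun z => ‖η z - (z ^ 2)⁻¹‖ ^ 2) 0 t =
      (t ^ 4)⁻¹ + ‖η 0‖ ^ 2 + Real.circleAverage (fun z => ‖η z - η 0‖ ^ 2) 0 t := by
  set F : ℂ → ℂ := fun z =>
    2 * (starRingEnd ℂ (η 0) * (η z - η 0) - z ^ 2 * η z / (t : ℂ) ^ 4) with hF
  have hcl : closedBall (0 : ℂ) t ⊆ ball 0 1 := closedBall_subset_ball ht1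
  have hFd : DifferentiableOn ℂ F (ball 0 1) := by
    rw [hF]
    fun_prop
  have hηc : ContinuousOn η (sphere 0 |t|) :=
    hη.continuousOn.mono ((abs_of_pos ht).symm ▸ sphere_subset_closedBall.trans hcl)
  have hFc : ContinuousOn F (sphere 0 |t|) :=
    hFd.continuousOn.mono ((abs_of_pos ht).symm ▸ sphere_subset_closedBall.trans hcl)
  have hF0 : Real.circleAverage F 0 t = 0 := by
    have hd : DiffContOnCl ℂ F (ball 0 |t|) := by
      rw [abs_of_pos ht]
      exact (hFd.mono hcl).diffContOnCl_ball subset_rfl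
    rw [hd.circleAverage]
    simp [hF]
  have hre : Real.circleAverage (fun z => (F z).re) 0 t = 0 := by
    have := Complex.reCLM.circleAverage_comp_comm hFc.circleIntegrable'
    rw [hF0] at this
    simpa [Function.comp_def] using this
  have hpt : ∀ z ∈ sphere (0 : ℂ) |t|, ‖η z - (z ^ 2)⁻¹‖ ^ 2 =
      ((t ^ 4)⁻¹ + ‖η 0‖ ^ 2) + (‖η z - η 0‖ ^ 2 + (F z).re) := by
    intro z hz
    have hzt : ‖z‖ = t := by simpa [abs_of_pos ht] using hz
    have hz0 : z ≠ 0 := by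
      rintro rfl
      simp at hzt
      exact ht.ne hzt
    have hcz : starRingEnd ℂ z = (t : ℂ) ^ 2 / z := by
      rw [eq_div_iff hz0, mul_comm, Complex.mul_conj, Complex.normSq_eq_norm_sq, hzt]
      push_cast
      rfl
    have ht0 : (t : ℂ) ≠ 0 := by exact_mod_cast ht.ne'
    have hcu : starRingEnd ℂ (z ^ 2)⁻¹ = z ^ 2 / (t : ℂ) ^ 4 := by
      rw [map_inv₀, map_pow, hcz]
      field_simp
    have hnu : Complex.normSq (z ^ 2)⁻¹ = (t ^ 4)⁻¹ := by
      rw [Complex.normSq_eq_norm_sq, norm_inv, norm_pow, hzt]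
      field_simp
    have e1 := Complex.normSq_sub (η z) ((z ^ 2)⁻¹)
    have e2 := Complex.normSq_sub (η z) (η 0)
    rw [hcu, hnu] at e1
    simp only [← Complex.normSq_eq_norm_sq]
    rw [e1, e2]
    have e3 : (F z).re = 2 * (η z * starRingEnd ℂ (η 0)).re - 2 * Complex.normSq (η 0)
        - 2 * (η z * (z ^ 2 / (t : ℂ) ^ 4)).re := by
      have : F z = 2 * (η z * starRingEnd ℂ (η 0)) - 2 * (Complex.normSq (η 0) : ℂ)
        - 2 * (η z * (z ^ 2 / (t : ℂ) ^ 4)) := by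
        rw [← Complex.mul_conj]
        simp only [hF]
        ring
      rw [this]
      simp
    rw [e3]
    ring
  have hχ : ContinuousOn (fun z => ‖η z - η 0‖ ^ 2) (sphere 0 |t|) := by fun_prop
  have hFr : ContinuousOn (fun z => (F z).re) (sphere 0 |t|) :=
    Complex.continuous_re.comp_continuousOn hFc
  rw [Real.circleAverage_congr_sphere hpt,
    Real.circleAverage_fun_add continuousOn_const.circleIntegrable'
      (ContinuousOn.circleIntegrable' (by fun_prop)),
    Real.circleAverage_fun_add hχ.circleIntegrable' hFr.circleIntegrable', hre,
    Real.circleAverage_const, add_zero]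

theorem continuousOn_norm_sq_sub_inv_sq {η : ℂ → ℂ} (hη : DifferentiableOn ℂ η (ball 0 1))
    {r ρ : ℝ} (hr : 0 < r) (hρ : ρ < 1) :
    ContinuousOn (fun z => ‖η z - (z ^ 2)⁻¹‖ ^ 2) {z | r ≤ ‖z‖ ∧ ‖z‖ ≤ ρ} := by
  have hηc : ContinuousOn η {z | r ≤ ‖z‖ ∧ ‖z‖ ≤ ρ} :=
    hη.continuousOn.mono fun z hz => by simpa using hz.2.trans_lt hρ
  refine ((hηc.sub ((continuousOn_id.pow 2).inv₀ fun z hz => ?_)).norm).pow 2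
  exact pow_ne_zero 2 (norm_pos_iff.1 (hr.trans_le hz.1))

theorem integral_annulus_norm_sq_sub_inv_sq {η : ℂ → ℂ} (hη : DifferentiableOn ℂ η (ball 0 1))
    {r ρ : ℝ} (hr : 0 < r) (hrρ : r < ρ) (hρ : ρ < 1) :
    ∫ z in annulus r ρ, ‖η z - (z ^ 2)⁻¹‖ ^ 2 =
      π * ((r ^ 2)⁻¹ - (ρ ^ 2)⁻¹) + π * ‖η 0‖ ^ 2 * (ρ ^ 2 - r ^ 2) +
        ∫ z in annulus r ρ, ‖η z - η 0‖ ^ 2 := by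
  have hηc : ContinuousOn η {z | r ≤ ‖z‖ ∧ ‖z‖ ≤ ρ} :=
    hη.continuousOn.mono fun z hz => by simpa using hz.2.trans_lt hρ
  have hχ : ContinuousOn (fun z => ‖η z - η 0‖ ^ 2) {z | r ≤ ‖z‖ ∧ ‖z‖ ≤ ρ} := by fun_prop
  have hA : ContinuousOn (Real.circleAverage (fun z => ‖η z - η 0‖ ^ 2) 0) (Icc r ρ) :=
    Real.ContinuousOn.circleAverage (by simpa using hχ) fun t ht => hr.le.trans ht.1
  have hC : ContinuousOn (fun t : ℝ => (2 * π * t) •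
      Real.circleAverage (fun z => ‖η z - η 0‖ ^ 2) 0 t) (Icc r ρ) :=
    (continuousOn_const.mul continuousOn_id).smul hA
  have hB : ContinuousOn (fun t : ℝ => 2 * π * t * ((t ^ 4)⁻¹ + ‖η 0‖ ^ 2)) (Icc r ρ) := by
    refine ContinuousOn.mul (by fun_prop) (ContinuousOn.add ?_ continuousOn_const)
    exact (continuousOn_id.pow 4).inv₀ fun t ht => pow_ne_zero 4 (hr.trans_le ht.1).ne'
  rw [integral_annulus hr (continuousOn_norm_sq_sub_inv_sq hη hr hρ), integral_annulus hr hχ,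
    setIntegral_congr_fun (g := fun t => 2 * π * t * ((t ^ 4)⁻¹ + ‖η 0‖ ^ 2) +
      (2 * π * t) • Real.circleAverage (fun z => ‖η z - η 0‖ ^ 2) 0 t) measurableSet_Ioo
      (fun t ht => by
        simp only [circleAverage_norm_sq_sub_inv_sq hη (hr.trans ht.1) (ht.2.trans hρ),
          smul_eq_mul]
        ring),
    integral_add (hB.integrableOn_Icc.mono_set Ioo_subset_Icc_self)
      (hC.integrableOn_Icc.mono_set Ioo_subset_Icc_self)]
  congr 1
  rw [← integral_Ioc_eq_integral_Ioo, ← intervalIntegral.integral_of_le hrρ.le,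
    intervalIntegral.integral_eq_sub_of_hasDerivAt_of_le
      (f := fun t => π * (‖η 0‖ ^ 2 * t ^ 2 - (t ^ 2)⁻¹)) hrρ.le]
  · ring
  · refine ContinuousOn.mul continuousOn_const (ContinuousOn.sub (by fun_prop) ?_)
    exact (continuousOn_id.pow 2).inv₀ fun t ht => pow_ne_zero 2 (hr.trans_le ht.1).ne'
  · intro t ht
    have ht0 : t ≠ 0 := (hr.trans ht.1).ne'
    have h2 := hasDerivAt_pow 2 t
    convert! ((h2.const_mul (‖η 0‖ ^ 2)).sub (h2.inv (pow_ne_zero 2 ht0))).const_mul π using 1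
    field_simp
    push_cast
    ring
  · exact (hB.mono (by rw [uIcc_of_le hrρ.le])).intervalIntegrable

/-- If the segment from `0 = h 0` to `u` avoids the image of the circle of radius `r` under the
univalent function `h`, then `u` lies in the image of the disc of radius `r`. -/
theorem mem_image_ball_of_forall_sphere_notMem_segment {h : ℂ → ℂ}
    (hd : DifferentiableOn ℂ h (ball 0 1)) (hinj : InjOn h (ball 0 1)) (h0 : h 0 = 0)
    {r : ℝ} (hr : 0 < r) (hr1 : r < 1) {u : ℂ}
    (hu : ∀ z, ‖z‖ = r → h z ∉ segment ℝ 0 u) : u ∈ h '' ball 0 r := by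
  have hcl : closedBall (0 : ℂ) r ⊆ ball 0 1 := closedBall_subset_ball hr1
  have hopen : IsOpen (h '' ball 0 r) := by
    rcases (hd.analyticOnNhd isOpen_ball).is_constant_or_isOpen
      (convex_ball 0 1).isPreconnected with ⟨w, hw⟩ | hop
    · exfalso
      have hrm : (r : ℂ) ∈ ball (0 : ℂ) 1 := by simpa [abs_of_pos hr] using hr1
      have h0m : (0 : ℂ) ∈ ball (0 : ℂ) 1 := by simp
      have := hinj hrm h0m ((hw _ hrm).trans (hw _ h0m).symm)
      exact hr.ne' (by exact_mod_cast this)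
    · exact hop _ (ball_subset_closedBall.trans hcl) isOpen_ball
  have hclosed : closure (h '' ball 0 r) ⊆ h '' closedBall 0 r :=
    closure_minimal (image_mono ball_subset_closedBall)
      (((isCompact_closedBall 0 r).image_of_continuousOn (hd.continuousOn.mono hcl)).isClosed)
  refine (convex_segment (𝕜 := ℝ) 0 u).isPreconnected.subset_of_closure_inter_subset hopen
    ⟨0, left_mem_segment ℝ 0 u, 0, by simpa using hr, h0⟩ ?_ (right_mem_segment ℝ 0 u)
  rintro w ⟨hw, hws⟩
  obtain ⟨z, hz, rfl⟩ := hclosed hw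
  have hz' : ‖z‖ ≤ r := by simpa using hz
  rcases hz'.lt_or_eq with hlt | heq
  · exact ⟨z, by simpa using hlt, rfl⟩
  · exact absurd hws (hu z heq)

theorem norm_sub_mul_conj_inv_le {h : ℂ → ℂ}
    (hd : DifferentiableOn ℂ h (ball 0 1)) (hinj : InjOn h (ball 0 1)) (h0 : h 0 = 0)
    {r : ℝ} (hr : 0 < r) {c : ℂ} {M : ℝ}
    (hM : ∀ z, ‖z‖ = r → ‖(h z)⁻¹ - c * (starRingEnd ℂ) (h z)⁻¹‖ ≤ M)
    {z : ℂ} (hrz : r < ‖z‖) (hz : ‖z‖ < 1) :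
    ‖(h z)⁻¹ - c * (starRingEnd ℂ) (h z)⁻¹‖ ≤ M := by
  by_contra! hlt
  have hzm : z ∈ ball (0 : ℂ) 1 := by simpa using hz
  obtain ⟨y, hy, hyz⟩ : h z ∈ h '' ball 0 r := by
    refine mem_image_ball_of_forall_sphere_notMem_segment hd hinj h0 hr (hrz.trans hz) ?_
    intro y hy hseg
    obtain ⟨s, ⟨hs0, hs1⟩, hs⟩ : ∃ s ∈ Icc (0 : ℝ) 1, s • h z = h y := by
      rw [segment_eq_image] at hseg
      simpa using hseg
    have hne : h y ≠ 0 := by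
      intro hy0
      have hym : y ∈ ball (0 : ℂ) 1 := by simpa [hy] using hrz.trans hz
      have := hinj hym (by simp) (hy0.trans h0.symm)
      simp [this] at hy
      exact hr.ne hy
    have hspos : 0 < s := lt_of_le_of_ne hs0 (by
      rintro rfl
      simp at hs
      exact hne hs.symm)
    have hyM := hM y hy
    have hinv : (h y)⁻¹ - c * (starRingEnd ℂ) (h y)⁻¹ =
        ((s⁻¹ : ℝ) : ℂ) * ((h z)⁻¹ - c * (starRingEnd ℂ) (h z)⁻¹) := by
      rw [← hs]
      simp
      ring
    rw [hinv, norm_mul, Complex.norm_real, Real.norm_of_nonneg (by positivity)] at hyM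
    have h1 : 1 ≤ s⁻¹ := (one_le_inv₀ hspos).2 hs1
    nlinarith [norm_nonneg ((h z)⁻¹ - c * (starRingEnd ℂ) (h z)⁻¹)]
  have hy' : ‖y‖ < r := by simpa using hy
  have := hinj (by simpa using hy'.trans (hrz.trans hz)) hzm hyz
  rw [this] at hy'
  exact absurd hrz hy'.not_gt

/-- The area of the image of an annulus under `1 / h` is at most the area of the filled ellipse
`{w | ‖w - c * conj w‖ ≤ M}` when the latter contains the image of the inner circle. -/
theorem area_annulus_le {h ψ : ℂ → ℂ}
    (hd : DifferentiableOn ℂ h (ball 0 1)) (hinj : InjOn h (ball 0 1)) (h0 : h 0 = 0)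
    (hψ : DifferentiableOn ℂ ψ (ball 0 1))
    (hhψ : ∀ z ∈ ball (0 : ℂ) 1, z ≠ 0 → (h z)⁻¹ = z⁻¹ + ψ z)
    {r ρ : ℝ} (hr : 0 < r) (hρ : ρ < 1)
    {c : ℂ} (hc : ‖c‖ < 1) {M : ℝ} (hM0 : 0 ≤ M)
    (hM : ∀ z, ‖z‖ = r → ‖(h z)⁻¹ - c * (starRingEnd ℂ) (h z)⁻¹‖ ≤ M) :
    ∫ z in annulus r ρ, ‖deriv ψ z - (z ^ 2)⁻¹‖ ^ 2 ≤ π * M ^ 2 / (1 - ‖c‖ ^ 2) := by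
  have hpos : 0 < 1 - ‖c‖ ^ 2 := by nlinarith [norm_nonneg c]
  have hball : ∀ z ∈ annulus r ρ, z ∈ ball (0 : ℂ) 1 := fun z hz => by
    simpa using hz.2.trans hρ
  have hne : ∀ z ∈ annulus r ρ, z ≠ 0 := fun z hz => norm_pos_iff.1 (hr.trans hz.1)
  have himg := volume_image_of_hasDerivAt (isOpen_annulus r ρ).measurableSet
    (φ := fun z => z⁻¹ + ψ z) (φ' := fun z => deriv ψ z - (z ^ 2)⁻¹)
    (fun z hz => by
      have := (hasDerivAt_inv (hne z hz)).add
        ((hψ.differentiableAt (isOpen_ball.mem_nhds (hball z hz))).hasDerivAt)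
      convert! this using 1
      ring)
    (fun z hz w hw hzw => by
      simp only [← hhψ z (hball z hz) (hne z hz), ← hhψ w (hball w hw) (hne w hw)] at hzw
      exact hinj (hball z hz) (hball w hw) (inv_injective hzw))
  have hsub : (fun z => z⁻¹ + ψ z) '' annulus r ρ ⊆
      {w : ℂ | ‖w - c * (starRingEnd ℂ) w‖ ≤ M} := by
    rintro _ ⟨z, hz, rfl⟩
    simp only [← hhψ z (hball z hz) (hne z hz)]
    exact norm_sub_mul_conj_inv_le hd hinj h0 hr hM hz.1 (hz.2.trans hρ)
  have hle := (measure_mono (μ := volume) hsub).trans_eq (volume_norm_sub_mul_conj_le hc hM0)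
  rw [himg] at hle
  rw [integral_eq_lintegral_of_nonneg_ae (ae_of_all _ fun z => by positivity)]
  · exact ENNReal.toReal_le_of_le_ofReal (by positivity) hle
  · exact ((continuousOn_norm_sq_sub_inv_sq (hψ.deriv isOpen_ball) hr hρ).mono
      fun z hz => ⟨hz.1.le, hz.2.le⟩).aestronglyMeasurable (isOpen_annulus r ρ).measurableSet

/-- Up to `o(r)`, the map `z ↦ 1 / z + ψ z` sends the circle of radius `r` to the ellipse that
`w ↦ w - ψ'(0) r² conj w` straightens to the circle of radius `1 / r`. -/
theorem eventually_norm_inv_sub_mul_conj_le {ψ : ℂ → ℂ} (hψ : DifferentiableAt ℂ ψ 0)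
    (hψ0 : ψ 0 = 0) {ε : ℝ} (hε : 0 < ε) :
    ∀ᶠ r : ℝ in 𝓝[>] 0, ∀ z : ℂ, ‖z‖ = r →
      ‖(z⁻¹ + ψ z) - deriv ψ 0 * r ^ 2 * (starRingEnd ℂ) (z⁻¹ + ψ z)‖ ≤ r⁻¹ + ε * r := by
  set b := deriv ψ 0 with hb
  have hlo := hψ.hasDerivAt.isLittleO.def (half_pos hε)
  obtain ⟨δ, hδ, hball⟩ := Metric.eventually_nhds_iff.1 hlo
  have hδr : ∀ᶠ r : ℝ in 𝓝[>] 0, r < δ :=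
    nhdsWithin_le_nhds (eventually_lt_nhds hδ)
  have hsmall : ∀ᶠ r : ℝ in 𝓝[>] 0, ‖b‖ * (ε / 2 + ‖b‖) * r ^ 2 < ε / 2 := by
    refine nhdsWithin_le_nhds (Tendsto.eventually_lt_const (half_pos hε) ?_)
    have : Continuous fun r : ℝ => ‖b‖ * (ε / 2 + ‖b‖) * r ^ 2 := by fun_prop
    simpa using this.tendsto 0
  filter_upwards [hδr, hsmall, self_mem_nhdsWithin] with r hrδ hrs hr z hz
  have hr0 : 0 < r := hr
  have hz0 : z ≠ 0 := norm_pos_iff.1 (hz ▸ hr0)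
  have h1 : ‖ψ z - b * z‖ ≤ ε / 2 * r := by
    have := hball (y := z) (by simpa [hz] using hrδ)
    simpa [hψ0, hz, hb, mul_comm] using this
  have h2 : ‖ψ z‖ ≤ (ε / 2 + ‖b‖) * r := by
    calc ‖ψ z‖ = ‖(ψ z - b * z) + b * z‖ := by ring_nf
      _ ≤ ‖ψ z - b * z‖ + ‖b * z‖ := norm_add_le _ _
      _ ≤ ε / 2 * r + ‖b‖ * r := by rw [norm_mul, hz]; gcongr
      _ = _ := by ring
  have hcz : (r : ℂ) ^ 2 * starRingEnd ℂ z⁻¹ = z := by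
    have : z * starRingEnd ℂ z = (r : ℂ) ^ 2 := by
      rw [Complex.mul_conj, Complex.normSq_eq_norm_sq, hz]
      push_cast
      rfl
    have hcz0 : starRingEnd ℂ z ≠ 0 := by simpa using hz0
    rw [map_inv₀, ← this]
    field_simp
  have hid : (z⁻¹ + ψ z) - b * r ^ 2 * (starRingEnd ℂ) (z⁻¹ + ψ z) =
      z⁻¹ + ((ψ z - b * z) - b * r ^ 2 * starRingEnd ℂ (ψ z)) := by
    rw [map_add]
    linear_combination (-b) * hcz
  have h3 : ‖b * (r : ℂ) ^ 2 * starRingEnd ℂ (ψ z)‖ ≤ ε / 2 * r := by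
    rw [norm_mul, norm_mul, norm_pow, Complex.norm_real, Real.norm_of_nonneg hr0.le,
      RCLike.norm_conj]
    calc ‖b‖ * r ^ 2 * ‖ψ z‖ ≤ ‖b‖ * r ^ 2 * ((ε / 2 + ‖b‖) * r) := by gcongr
      _ = (‖b‖ * (ε / 2 + ‖b‖) * r ^ 2) * r := by ring
      _ ≤ ε / 2 * r := by gcongr
  rw [hid]
  calc _ ≤ ‖z⁻¹‖ + (‖ψ z - b * z‖ + ‖b * (r : ℂ) ^ 2 * starRingEnd ℂ (ψ z)‖) :=
        (norm_add_le _ _).trans (by gcongr; exact norm_sub_le _ _)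
    _ ≤ r⁻¹ + (ε / 2 * r + ε / 2 * r) := by rw [norm_inv, hz]; gcongr
    _ = _ := by ring

theorem integrableOn_annulus_norm_sq_sub {η : ℂ → ℂ} (hη : DifferentiableOn ℂ η (ball 0 1))
    {r ρ : ℝ} (hρ : ρ < 1) :
    IntegrableOn (fun z => ‖η z - η 0‖ ^ 2) (annulus r ρ) := by
  have hc : ContinuousOn η (closedBall 0 ρ) :=
    hη.continuousOn.mono (closedBall_subset_ball hρ)
  have : ContinuousOn (fun z => ‖η z - η 0‖ ^ 2) (closedBall 0 ρ) := by fun_prop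
  exact (this.integrableOn_compact (isCompact_closedBall 0 ρ)).mono_set
    fun z hz => by simpa using hz.2.le

theorem integral_annulus_norm_sq_sub_mono {η : ℂ → ℂ} (hη : DifferentiableOn ℂ η (ball 0 1))
    {r r' ρ ρ' : ℝ} (hr : r' ≤ r) (hρ : ρ ≤ ρ') (hρ1 : ρ' < 1) :
    ∫ z in annulus r ρ, ‖η z - η 0‖ ^ 2 ≤ ∫ z in annulus r' ρ', ‖η z - η 0‖ ^ 2 :=
  setIntegral_mono_set (integrableOn_annulus_norm_sq_sub hη hρ1)
    (ae_of_all _ fun z => by positivity)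
    (LE.le.eventuallyLE fun _ hz => ⟨hr.trans_lt hz.1, hz.2.trans_le hρ⟩)

/-- A form of Grönwall's area theorem: if `z ↦ 1 / h z = 1 / z + ψ z` with `h` univalent on the
unit disc, then the Dirichlet integral of `ψ` is at most `π`, in the limit `r → 0`, `ρ → 1`. -/
theorem area_theorem {h ψ : ℂ → ℂ}
    (hd : DifferentiableOn ℂ h (ball 0 1)) (hinj : InjOn h (ball 0 1)) (h0 : h 0 = 0)
    (hψ : DifferentiableOn ℂ ψ (ball 0 1)) (hψ0 : ψ 0 = 0)
    (hhψ : ∀ z ∈ ball (0 : ℂ) 1, z ≠ 0 → (h z)⁻¹ = z⁻¹ + ψ z)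
    {r ρ : ℝ} (hr : 0 < r) (hrρ : r < ρ) (hρ : ρ < 1) :
    π * ‖deriv ψ 0‖ ^ 2 * (ρ ^ 2 - r ^ 2) +
      ∫ z in annulus r ρ, ‖deriv ψ z - deriv ψ 0‖ ^ 2 ≤ π * (ρ ^ 2)⁻¹ := by
  set b := deriv ψ 0 with hb
  have hη : DifferentiableOn ℂ (deriv ψ) (ball 0 1) := hψ.deriv isOpen_ball
  set K : ℝ := π * ‖b‖ ^ 2 * (ρ ^ 2 - r ^ 2) +
    (∫ z in annulus r ρ, ‖deriv ψ z - b‖ ^ 2) - π * (ρ ^ 2)⁻¹ with hK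
  suffices ∀ ε > 0, K ≤ π * (2 * ε) by
    have h0 : Tendsto (fun ε : ℝ => π * (2 * ε)) (𝓝[>] 0) (𝓝 0) := by
      have : Continuous fun ε : ℝ => π * (2 * ε) := by fun_prop
      simpa using (this.tendsto 0).mono_left nhdsWithin_le_nhds
    have := ge_of_tendsto h0 (by filter_upwards [self_mem_nhdsWithin] with ε hε using this ε hε)
    linarith
  intro ε hε
  have hlim : Tendsto (fun s : ℝ => π * (2 * ε) + s ^ 2 * (π * ε ^ 2 + π * ‖b‖ ^ 2 +
      ‖b‖ ^ 2 * s ^ 2 * K)) (𝓝[>] 0) (𝓝 (π * (2 * ε))) := by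
    have : Continuous fun s : ℝ => π * (2 * ε) + s ^ 2 * (π * ε ^ 2 + π * ‖b‖ ^ 2 +
      ‖b‖ ^ 2 * s ^ 2 * K) := by fun_prop
    simpa using (this.tendsto 0).mono_left nhdsWithin_le_nhds
  have hsmall : ∀ᶠ s : ℝ in 𝓝[>] 0, ‖b‖ * s ^ 2 < 1 := by
    refine nhdsWithin_le_nhds (Tendsto.eventually_lt_const one_pos ?_)
    have : Continuous fun s : ℝ => ‖b‖ * s ^ 2 := by fun_prop
    simpa using this.tendsto 0
  refine ge_of_tendsto hlim ?_
  filter_upwards [self_mem_nhdsWithin, nhdsWithin_le_nhds (eventually_lt_nhds hr), hsmall,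
    eventually_norm_inv_sub_mul_conj_le
      (hψ.differentiableAt (isOpen_ball.mem_nhds (by simp))) hψ0 hε] with s hs hsr hbs hM
  have hs0 : 0 < s := hs
  have hcn : ‖b * (s : ℂ) ^ 2‖ = ‖b‖ * s ^ 2 := by simp
  have harea := area_annulus_le hd hinj h0 hψ hhψ hs0 hρ (c := b * (s : ℂ) ^ 2)
    (by rwa [hcn]) (M := s⁻¹ + ε * s) (by positivity) (fun z hz => by
      rw [hhψ z (by simpa [hz] using hsr.trans (hrρ.trans hρ)) (norm_pos_iff.1 (hz ▸ hs0))]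
      exact hM z hz)
  rw [integral_annulus_norm_sq_sub_inv_sq hη hs0 (hsr.trans hrρ) hρ, hcn] at harea
  have hmono := integral_annulus_norm_sq_sub_mono hη hsr.le le_rfl hρ (ρ := ρ)
  have hpos : 0 < 1 - (‖b‖ * s ^ 2) ^ 2 :=
    sub_pos.2 (pow_lt_one₀ (by positivity) hbs two_ne_zero)
  rw [le_div_iff₀ hpos] at harea
  have hKle : π * (s ^ 2)⁻¹ + K ≤ π * ((s ^ 2)⁻¹ - (ρ ^ 2)⁻¹) + π * ‖b‖ ^ 2 * (ρ ^ 2 - s ^ 2) +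
      ∫ z in annulus s ρ, ‖deriv ψ z - b‖ ^ 2 := by
    have : π * ‖b‖ ^ 2 * (ρ ^ 2 - r ^ 2) ≤ π * ‖b‖ ^ 2 * (ρ ^ 2 - s ^ 2) := by gcongr
    rw [hK]
    linarith
  have := (mul_le_mul_of_nonneg_right hKle hpos.le).trans harea
  have e1 : (π * (s ^ 2)⁻¹ + K) * (1 - (‖b‖ * s ^ 2) ^ 2) =
      π * (s ^ 2)⁻¹ + K - s ^ 2 * (π * ‖b‖ ^ 2 + ‖b‖ ^ 2 * s ^ 2 * K) := by
    field_simp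
  have e2 : π * (s⁻¹ + ε * s) ^ 2 = π * (s ^ 2)⁻¹ + π * (2 * ε) + s ^ 2 * (π * ε ^ 2) := by
    field_simp
    ring
  rw [e1, e2] at this
  linarith

theorem norm_deriv_le_one_and_eq_of_area {h ψ : ℂ → ℂ}
    (hd : DifferentiableOn ℂ h (ball 0 1)) (hinj : InjOn h (ball 0 1)) (h0 : h 0 = 0)
    (hψ : DifferentiableOn ℂ ψ (ball 0 1)) (hψ0 : ψ 0 = 0)
    (hhψ : ∀ z ∈ ball (0 : ℂ) 1, z ≠ 0 → (h z)⁻¹ = z⁻¹ + ψ z) :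
    ‖deriv ψ 0‖ ≤ 1 ∧ (‖deriv ψ 0‖ = 1 → ∀ z ∈ ball (0 : ℂ) 1, ψ z = deriv ψ 0 * z) := by
  set b := deriv ψ 0 with hb
  have hη : DifferentiableOn ℂ (deriv ψ) (ball 0 1) := hψ.deriv isOpen_ball
  have harea : ∀ᶠ s : ℝ in 𝓝[<] 1, π * ‖b‖ ^ 2 * (s ^ 2 - (1 - s) ^ 2) +
      ∫ z in annulus (1 - s) s, ‖deriv ψ z - b‖ ^ 2 ≤ π * (s ^ 2)⁻¹ := by
    filter_upwards [self_mem_nhdsWithin,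
      nhdsWithin_le_nhds (eventually_gt_nhds (by norm_num : (1 / 2 : ℝ) < 1))] with s hs hs2
    have hs1 : s < 1 := hs
    exact area_theorem hd hinj h0 hψ hψ0 hhψ (by linarith) (by linarith) hs1
  have hinv : Tendsto (fun s : ℝ => π * (s ^ 2)⁻¹) (𝓝[<] 1) (𝓝 π) := by
    have : ContinuousAt (fun s : ℝ => π * (s ^ 2)⁻¹) 1 := by
      refine ContinuousAt.mul continuousAt_const (ContinuousAt.inv₀ (by fun_prop) (by norm_num))
    simpa using this.tendsto.mono_left nhdsWithin_le_nhds
  have hquad : Tendsto (fun s : ℝ => π * ‖b‖ ^ 2 * (s ^ 2 - (1 - s) ^ 2)) (𝓝[<] 1)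
      (𝓝 (π * ‖b‖ ^ 2)) := by
    have : Continuous fun s : ℝ => π * ‖b‖ ^ 2 * (s ^ 2 - (1 - s) ^ 2) := by fun_prop
    simpa using (this.tendsto 1).mono_left nhdsWithin_le_nhds
  refine ⟨?_, fun hb1 => ?_⟩
  · have hle : π * ‖b‖ ^ 2 ≤ π := by
      refine le_of_tendsto_of_tendsto hquad hinv ?_
      filter_upwards [harea] with s hs
      have : 0 ≤ ∫ z in annulus (1 - s) s, ‖deriv ψ z - b‖ ^ 2 :=
        integral_nonneg fun z => by positivity
      linarith
    have : ‖b‖ ^ 2 ≤ 1 := by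
      by_contra! hlt
      nlinarith [Real.pi_pos]
    exact (sq_le_one_iff₀ (norm_nonneg b)).1 this
  · have hzero : ∀ r ρ : ℝ, 0 < r → ρ < 1 →
        ∫ z in annulus r ρ, ‖deriv ψ z - b‖ ^ 2 = 0 := by
      intro r ρ hr hρ
      refine le_antisymm ?_ (integral_nonneg fun z => by positivity)
      have hlim := hinv.sub hquad
      rw [hb1, one_pow, mul_one, sub_self] at hlim
      refine ge_of_tendsto hlim ?_
      filter_upwards [harea, self_mem_nhdsWithin,
        nhdsWithin_le_nhds (eventually_gt_nhds (by linarith : 1 - r < 1)),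
        nhdsWithin_le_nhds (eventually_gt_nhds hρ)] with s hs hs1 hsr hsρ
      have := integral_annulus_norm_sq_sub_mono hη (r := r) (ρ := ρ) (r' := 1 - s) (by linarith)
        hsρ.le hs1
      rw [hb1] at hs
      linarith
    have hderiv : ∀ z ∈ ball (0 : ℂ) 1, deriv ψ z = b := by
      intro z hz
      rcases eq_or_ne z 0 with rfl | hz0
      · rfl
      have hz1 : ‖z‖ < 1 := by simpa using hz
      have hzpos : 0 < ‖z‖ := norm_pos_iff.2 hz0
      obtain ⟨ρ, hzρ, hρ⟩ := exists_between hz1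
      have hae := (setIntegral_eq_zero_iff_of_nonneg_ae (ae_of_all _ fun z => by positivity)
        (integrableOn_annulus_norm_sq_sub hη hρ)).1 (hzero (‖z‖ / 2) ρ (by positivity) hρ)
      have hcont : ContinuousOn (deriv ψ) (annulus (‖z‖ / 2) ρ) :=
        hη.continuousOn.mono fun w hw => by simpa using hw.2.trans hρ
      have := Measure.eqOn_open_of_ae_eq hae (isOpen_annulus _ _) (by fun_prop) continuousOn_const
        (x := z) ⟨by linarith, hzρ⟩
      simpa [sub_eq_zero] using this
    intro z hz
    have hdiff : DifferentiableOn ℂ (fun z => ψ z - b * z) (ball 0 1) := by fun_prop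
    have := isOpen_ball.is_const_of_deriv_eq_zero (convex_ball (0 : ℂ) 1).isPreconnected hdiff
      (fun w hw => by
        have h1 := ((hψ.differentiableAt (isOpen_ball.mem_nhds hw)).hasDerivAt.sub
          ((hasDerivAt_id w).const_mul b)).deriv
        rw [hderiv w hw] at h1
        simpa [Pi.sub_def] using h1) hz (y := 0) (by simp)
    simpa [hψ0, sub_eq_zero] using this

theorem coeff_eq_dslope_of_hasSum {f : ℂ → ℂ} {a : ℕ → ℂ}
    (hexp : ∀ z ∈ ball (0 : ℂ) 1, HasSum (fun n : ℕ => a n * z ^ n) (f z)) :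
    f 0 = a 0 ∧ dslope f 0 0 = a 1 ∧ deriv (dslope f 0) 0 = a 2 := by
  have hp : HasFPowerSeriesAt f (FormalMultilinearSeries.ofScalars ℂ a) 0 := by
    rw [hasFPowerSeriesAt_iff]
    filter_upwards [isOpen_ball.mem_nhds (mem_ball_self one_pos)] with z hz
    simpa [mul_comm] using hexp z hz
  have hq := hp.has_fpower_series_dslope_fslope
  refine ⟨?_, ?_, ?_⟩
  · rw [← hp.coeff_zero (fun _ => 1)]
    simp
  · rw [dslope_same, hp.deriv]
    simp
  · rw [hq.deriv]
    change _root_.FormalMultilinearSeries.coeff _ 1 = _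
    rw [FormalMultilinearSeries.coeff_fslope]
    simp

/-- A zero-free holomorphic function on the disc has a holomorphic inverse square root. -/
theorem exists_inv_sqrt {q : ℂ → ℂ} (hq : DifferentiableOn ℂ q (ball 0 1))
    (hq0 : ∀ z ∈ ball (0 : ℂ) 1, q z ≠ 0) (hq1 : q 0 = 1) :
    ∃ m : ℂ → ℂ, DifferentiableOn ℂ m (ball 0 1) ∧ m 0 = 1 ∧ deriv m 0 = - deriv q 0 / 2 ∧
      ∀ z ∈ ball (0 : ℂ) 1, q z * m z ^ 2 = 1 := by
  have hq' := hq.deriv isOpen_ball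
  obtain ⟨l, hl0, hl⟩ := (hq'.div hq hq0).isExactOn_ball.with_val_at 0 0
  have hm : ∀ z ∈ ball (0 : ℂ) 1, HasDerivAt (fun z => Complex.exp (-l z / 2))
      (Complex.exp (-l z / 2) * (-(deriv q z / q z) / 2)) z :=
    fun z hz => ((hl z hz).neg.div_const 2).cexp
  have h0 : (0 : ℂ) ∈ ball (0 : ℂ) 1 := by simp
  refine ⟨_, fun z hz => (hm z hz).differentiableAt.differentiableWithinAt, by simp [hl0], ?_, ?_⟩
  · rw [(hm 0 h0).deriv]
    simp [hl0, hq1, neg_div]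
  · intro z hz
    have hder : ∀ w ∈ ball (0 : ℂ) 1,
        HasDerivAt (fun z => q z * Complex.exp (-l z / 2) ^ 2) 0 w := by
      intro w hw
      have := (hq.differentiableAt (isOpen_ball.mem_nhds hw)).hasDerivAt.mul ((hm w hw).pow 2)
      convert! this using 1
      have := hq0 w hw
      simp
      field_simp
      ring
    have := isOpen_ball.is_const_of_deriv_eq_zero (convex_ball (0 : ℂ) 1).isPreconnected
      (fun w hw => (hder w hw).differentiableAt.differentiableWithinAt)
      (fun w hw => (hder w hw).deriv) hz h0
    simpa [hl0, hq1] using this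

/-- The square-root transform of `f`: if `f z * m z ^ 2 = z`, then `h z = z / m (z ^ 2)` satisfies
`h z ^ 2 = f (z ^ 2)`, and it is univalent when `f` is. -/
theorem injOn_sqrt_transform {f m : ℂ → ℂ} (hinj : InjOn f (ball 0 1))
    (hm : ∀ z ∈ ball (0 : ℂ) 1, m z ≠ 0)
    (hfm : ∀ z ∈ ball (0 : ℂ) 1, f z * m z ^ 2 = z) :
    InjOn (fun z => z / m (z ^ 2)) (ball 0 1) := by
  have hsq : ∀ z ∈ ball (0 : ℂ) 1, z ^ 2 ∈ ball (0 : ℂ) 1 := fun z hz => by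
    have : ‖z‖ < 1 := by simpa using hz
    simpa using this
  intro z hz w hw hzw
  have hsqrt : ∀ z ∈ ball (0 : ℂ) 1, (z / m (z ^ 2)) ^ 2 = f (z ^ 2) := by
    intro z hz
    rw [div_pow, div_eq_iff (pow_ne_zero 2 (hm _ (hsq z hz))), hfm _ (hsq z hz)]
  have hzw' : z / m (z ^ 2) = w / m (w ^ 2) := hzw
  have heq : z ^ 2 = w ^ 2 := hinj (hsq z hz) (hsq w hw) (by
    rw [← hsqrt z hz, ← hsqrt w hw, hzw'])
  rw [heq] at hzw'
  exact (div_left_inj' (hm _ (hsq w hw))).1 hzw'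

theorem deriv_inv_one_sub_mul_sq (e : ℂ) :
    deriv (fun z : ℂ => ((1 - e * z) ^ 2)⁻¹) 0 = 2 * e := by
  have h1 : HasDerivAt (fun z : ℂ => 1 - e * z) (-e) 0 := by
    simpa using ((hasDerivAt_id (0 : ℂ)).const_mul e).const_sub 1
  have h2 := ((h1.pow 2).inv (by simp)).deriv
  simpa [Pi.inv_def, Pi.pow_def] using h2

/-- Bieberbach's theorem: for `f ∈ S` with power series `f(z) = z + Σ_{n≥2} aₙ zⁿ` on the
unit disc, we have `|a₂| ≤ 2`, with equality iff `f` is a rotated Koebe function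
`z ↦ z/(1 - e^{iα} z)²`. -/
theorem bieberbach_second_coefficient
    (f : ℂ → ℂ) (a : ℕ → ℂ)
    (hinj : Set.InjOn f (Metric.ball (0 : ℂ) 1))
    (hhol : DifferentiableOn ℂ f (Metric.ball (0 : ℂ) 1))
    (ha0 : a 0 = 0) (ha1 : a 1 = 1)
    (hexp : ∀ z ∈ Metric.ball (0 : ℂ) 1, HasSum (fun n : ℕ => a n * z ^ n) (f z)) :
    ‖a 2‖ ≤ 2 ∧
    (‖a 2‖ = 2 ↔ ∃ α : ℝ, ∀ z ∈ Metric.ball (0 : ℂ) 1,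
      f z = z / (1 - Complex.exp ((α : ℂ) * Complex.I) * z) ^ 2) := by
  obtain ⟨hf0, hq1, hq2⟩ := coeff_eq_dslope_of_hasSum hexp
  rw [ha0] at hf0
  rw [ha1] at hq1
  have h0 : (0 : ℂ) ∈ ball (0 : ℂ) 1 := by simp
  have hqf : ∀ z, dslope f 0 z * z = f z := fun z => by
    simpa [hf0, mul_comm] using sub_smul_dslope f 0 z
  have hqd : DifferentiableOn ℂ (dslope f 0) (ball 0 1) :=
    (Complex.differentiableOn_dslope (isOpen_ball.mem_nhds h0)).2 hhol
  have hq0 : ∀ z ∈ ball (0 : ℂ) 1, dslope f 0 z ≠ 0 := by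
    intro z hz hzero
    have hfz := hqf z
    rw [hzero, zero_mul] at hfz
    obtain rfl := hinj hz h0 (hfz.symm.trans hf0.symm)
    rw [hq1] at hzero
    exact one_ne_zero hzero
  obtain ⟨m, hmd, hm1, hm', hqm⟩ := exists_inv_sqrt hqd hq0 hq1
  have hm0 : ∀ z ∈ ball (0 : ℂ) 1, m z ≠ 0 := by
    intro z hz hzero
    simpa [hzero] using hqm z hz
  have hfm : ∀ z ∈ ball (0 : ℂ) 1, f z * m z ^ 2 = z := by
    intro z hz
    rw [← hqf z]
    linear_combination z * hqm z hz
  have hsq : MapsTo (fun z : ℂ => z ^ 2) (ball 0 1) (ball 0 1) := fun z hz => by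
    have : ‖z‖ < 1 := by simpa using hz
    simpa using this
  have hsqd : DifferentiableOn ℂ (fun z : ℂ => z ^ 2) (ball 0 1) := by fun_prop
  set n := dslope m 0 with hn
  have hnd : DifferentiableOn ℂ n (ball 0 1) :=
    (Complex.differentiableOn_dslope (isOpen_ball.mem_nhds h0)).2 hmd
  have hmn : ∀ z, m z = 1 + z * n z := fun z => by
    have := sub_smul_dslope m 0 z
    rw [hm1] at this
    simp only [sub_zero, smul_eq_mul] at this
    rw [hn, this]
    ring
  have hψd : DifferentiableOn ℂ (fun z => z * n (z ^ 2)) (ball 0 1) :=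
    differentiableOn_id.mul (hnd.comp hsqd hsq)
  have hψ' : deriv (fun z => z * n (z ^ 2)) 0 = -a 2 / 2 := by
    have hd : DifferentiableAt ℂ (fun z => n (z ^ 2)) 0 :=
      (hnd.comp hsqd hsq).differentiableAt (isOpen_ball.mem_nhds h0)
    have := ((hasDerivAt_id (0 : ℂ)).mul hd.hasDerivAt).deriv
    simpa [Pi.mul_def, hn, dslope_same, hm', hq2] using this
  obtain ⟨hle, heq⟩ := norm_deriv_le_one_and_eq_of_area
    (h := fun z => z / m (z ^ 2)) (ψ := fun z => z * n (z ^ 2))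
    (differentiableOn_id.div (hmd.comp hsqd hsq) fun z hz => hm0 _ (hsq hz))
    (injOn_sqrt_transform hinj hm0 hfm) (by simp) hψd (by simp) (fun z _ hz0 => by
      rw [inv_div, hmn]
      field_simp)
  simp only [hψ', norm_div, norm_neg, Complex.norm_ofNat] at hle heq
  refine ⟨by linarith, fun h2 => ?_, ?_⟩
  · have hlin := heq (by rw [h2]; norm_num)
    have hexp_arg : Complex.exp ((Complex.arg (a 2 / 2) : ℂ) * Complex.I) = a 2 / 2 := by
      have := Complex.norm_mul_exp_arg_mul_I (a 2 / 2)
      simpa [h2] using this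
    refine ⟨Complex.arg (a 2 / 2), fun z hz => ?_⟩
    rw [hexp_arg]
    obtain ⟨w, rfl⟩ : ∃ w : ℂ, w ^ 2 = z := IsAlgClosed.exists_pow_nat_eq z two_pos
    have hw : w ∈ ball (0 : ℂ) 1 := by
      have : ‖w‖ ^ 2 < 1 := by simpa using hz
      simpa using (sq_lt_one_iff₀ (norm_nonneg w)).1 this
    have hmw : m (w ^ 2) = 1 - a 2 / 2 * w ^ 2 := by
      rw [hmn]
      linear_combination w * hlin w hw
    rw [← hmw, eq_div_iff (pow_ne_zero 2 (hm0 _ hz)), hfm _ hz]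
  · rintro ⟨α, hα⟩
    set e := Complex.exp ((α : ℂ) * Complex.I) with he
    have hen : ‖e‖ = 1 := Complex.norm_exp_ofReal_mul_I α
    have hev : dslope f 0 =ᶠ[𝓝 0] fun z => ((1 - e * z) ^ 2)⁻¹ := by
      filter_upwards [isOpen_ball.mem_nhds h0] with z hz
      rcases eq_or_ne z 0 with rfl | hz0
      · rw [hq1]
        simp
      · apply mul_right_cancel₀ hz0
        rw [hqf, hα z hz]
        ring
    rw [← hq2, hev.deriv_eq, deriv_inv_one_sub_mul_sq, norm_mul, hen]
    simp
end
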